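/- Let P be a Gorenstein polytope of degree d. Then Vol(P) ≤ (2d−1)^{2d−1} · ((2d−1)!)^{2d} · 14^{(2d−1)²·2^{2d}}. -/

import Mathlib

open scoped BigOperators Pointwise

noncomputable section

/-- A point of `ℝ^m` with integer coordinates (a lattice point). -/
def IsLatticePoint {m : ℕ} (v : Fin m → ℝ) : Prop := ∀ i, ∃ z : ℤ, v i = (z : ℝ)

/-- `P` is a lattice polytope in `ℝ^m`: the convex hull of a nonempty finite set of
lattice points. -/
def IsLatticePolytope {m : ℕ} (P : Set (Fin m → ℝ)) : Prop :=
  ∃ V : Finset (Fin m → ℝ), V.Nonempty ∧ (∀ v ∈ V, IsLatticePoint v) ∧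
    P = convexHull ℝ (V : Set (Fin m → ℝ))

/-- The number of lattice points contained in a subset of `ℝ^m`. -/
def latticePointCount {m : ℕ} (A : Set (Fin m → ℝ)) : ℕ :=
  Set.ncard {z : Fin m → ℤ | (fun i => (z i : ℝ)) ∈ A}

/-- `h` is the `h^*`-polynomial of the full-dimensional lattice polytope `P ⊆ ℝ^n`:
its coefficients are nonnegative, it has degree at most `n`, and the Ehrhart counting
function of `P` is given by `|mP ∩ ℤ^n| = ∑_i h_i * C(n + m - i, n)`, which is
equivalent to `∑_m |mP ∩ ℤ^n| t^m = h(t)/(1-t)^{n+1}`. -/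
def IsHStarPoly {n : ℕ} (P : Set (Fin n → ℝ)) (h : Polynomial ℤ) : Prop :=
  h.natDegree ≤ n ∧ (∀ i, 0 ≤ h.coeff i) ∧
    ∀ m : ℕ, (latticePointCount ((m : ℝ) • P) : ℤ) =
      ∑ i ∈ Finset.range (n + 1), h.coeff i * ((n + m - i).choose n : ℤ)

/-- The normalized volume of a (full-dimensional) polytope in `ℝ^m`:
`m!` times its Euclidean volume. -/
def normVol {m : ℕ} (P : Set (Fin m → ℝ)) : ℝ :=
  (Nat.factorial m : ℝ) * (MeasureTheory.volume P).toReal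

/-- The point of `ℝ^s` over which the `j`-th summand of a Cayley sum sits:
`0` for `j = 0`, and the standard basis vector `e_j` for `j = 1, …, s`. -/
def cayleyVertex (s : ℕ) (j : Fin (s + 1)) : Fin s → ℝ :=
  fun i => if (i : ℕ) + 1 = (j : ℕ) then 1 else 0

/-- The Cayley sum `P_0 * ⋯ * P_s ⊆ ℝ^q × ℝ^s` of polytopes `P_0, …, P_s ⊆ ℝ^q`:
the convex hull of `(P_0 × {0}) ∪ (P_1 × {e_1}) ∪ ⋯ ∪ (P_s × {e_s})`. -/
def CayleySum {q s : ℕ} (Ps : Fin (s + 1) → Set (Fin q → ℝ)) :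
    Set ((Fin q → ℝ) × (Fin s → ℝ)) :=
  convexHull ℝ (⋃ j : Fin (s + 1), (fun p => (p, cayleyVertex s j)) '' Ps j)

/-- A lattice point of `ℝ^q × ℝ^s`. -/
def IsLatticePointPair {q s : ℕ} (v : (Fin q → ℝ) × (Fin s → ℝ)) : Prop :=
  IsLatticePoint v.1 ∧ IsLatticePoint v.2

/-- An affine isomorphism `ℝ^n ≅ ℝ^q × ℝ^s` is a `ℤ`-affine linear change of coordinates
if it identifies the lattice `ℤ^n` with the lattice `ℤ^q × ℤ^s`. -/
def IsLatticeEquiv {n q s : ℕ} (T : (Fin n → ℝ) ≃ᵃ[ℝ] (Fin q → ℝ) × (Fin s → ℝ)) : Prop :=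
  ∀ v : Fin n → ℝ, IsLatticePoint v ↔ IsLatticePointPair (T v)

namespace GorensteinCone

open Filter Topology

section

variable {E J : Type*} [AddCommGroup E] [Module ℝ E] [Fintype J]

/-- The convex cone generated by a finite family of vectors. -/
def coneHull (v : J → E) : Set E := {x | ∃ c : J → ℝ, (∀ i, 0 ≤ c i) ∧ ∑ i, c i • v i = x}

/-- The members of the family `v` indexed by `S` form a basis. -/
def IsBas (v : J → E) (S : Finset J) : Prop :=
  LinearIndepOn ℝ v (S : Set J) ∧ Submodule.span ℝ (v '' (S : Set J)) = ⊤

lemma coneHull_add {v : J → E} {x y : E} (hx : x ∈ coneHull v) (hy : y ∈ coneHull v) :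
    x + y ∈ coneHull v := by
  obtain ⟨c, hc, rfl⟩ := hx
  obtain ⟨c', hc', rfl⟩ := hy
  exact ⟨fun i => c i + c' i, fun i => add_nonneg (hc i) (hc' i), by
    simp [add_smul, Finset.sum_add_distrib]⟩

lemma coneHull_smul {v : J → E} {x : E} {a : ℝ} (ha : 0 ≤ a) (hx : x ∈ coneHull v) :
    a • x ∈ coneHull v := by
  obtain ⟨c, hc, rfl⟩ := hx
  exact ⟨fun i => a * c i, fun i => mul_nonneg ha (hc i), by
    simp [mul_smul, Finset.smul_sum]⟩

lemma mem_coneHull (v : J → E) (i : J) : v i ∈ coneHull v := by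
  classical
  exact ⟨fun j => if j = i then 1 else 0, fun j => by positivity, by simp⟩

lemma zero_mem_coneHull (v : J → E) : (0 : E) ∈ coneHull v :=
  ⟨0, fun _ => le_rfl, by simp⟩

lemma sum_mem_coneHull {ι : Type*} {v : J → E} (s : Finset ι) (f : ι → E)
    (h : ∀ i ∈ s, f i ∈ coneHull v) : ∑ i ∈ s, f i ∈ coneHull v :=
  Finset.sum_induction f (· ∈ coneHull v) (fun _ _ => coneHull_add) (zero_mem_coneHull v) h

lemma coneHull_nonneg {v : J → E} {f : E →ₗ[ℝ] ℝ} (hf : ∀ i, 0 ≤ f (v i)) {x : E}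
    (hx : x ∈ coneHull v) : 0 ≤ f x := by
  obtain ⟨c, hc, rfl⟩ := hx
  simp only [map_sum, map_smul, smul_eq_mul]
  exact Finset.sum_nonneg fun i _ => mul_nonneg (hc i) (hf i)

/-- Carathéodory reduction of a conic combination to a linearly independent family, keeping one
prescribed generator in the support. -/
lemma exists_linearIndepOn_support {v : J → E} {e : E →ₗ[ℝ] ℝ} (he : ∀ i, 0 < e (v i))
    (c : J → ℝ) (hc : ∀ i, 0 ≤ c i) (j : J) (hj : 0 < c j) :
    ∃ c' : J → ℝ, (∀ i, 0 ≤ c' i) ∧ ∑ i, c' i • v i = ∑ i, c i • v i ∧ 0 < c' j ∧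
      LinearIndepOn ℝ v {i | c' i ≠ 0} := by
  classical
  induction hn : (Finset.univ.filter fun i => c i ≠ 0).card using Nat.strong_induction_on
    generalizing c with
  | _ n ih =>
  by_cases hli : LinearIndepOn ℝ v {i | c i ≠ 0}
  · exact ⟨c, hc, rfl, hj, hli⟩
  have hcoe : {i | c i ≠ 0} = ((Finset.univ.filter fun i => c i ≠ 0 : Finset J) : Set J) := by
    ext; simp
  rw [hcoe, linearIndepOn_finset_iff] at hli
  push Not at hli
  obtain ⟨g, hg0, i0, hi0, hgi0⟩ := hli
  -- normalise so that the kept index moves upwards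
  obtain ⟨g, hgs, hg0, hgj, i0, hgi0⟩ : ∃ g : J → ℝ, (∀ i, c i = 0 → g i = 0) ∧
      ∑ i, g i • v i = 0 ∧ 0 ≤ g j ∧ ∃ i, g i ≠ 0 := by
    have h0 : ∑ i, (if c i ≠ 0 then g i else 0) • v i = 0 := by
      rw [← hg0, Finset.sum_filter]
      exact Finset.sum_congr rfl fun i _ => by split_ifs <;> simp
    have hi0' : c i0 ≠ 0 := by simpa using hi0
    rcases le_total 0 (g j) with h | h
    · exact ⟨fun i => if c i ≠ 0 then g i else 0, fun i hi => by simp [hi], h0, by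
        simp [hj.ne', h], i0, by simp [hi0', hgi0]⟩
    · refine ⟨fun i => -(if c i ≠ 0 then g i else 0), fun i hi => by simp [hi], ?_, by
        simp [hj.ne', h], i0, by simp [hi0', hgi0]⟩
      simp only [neg_smul, Finset.sum_neg_distrib, h0, neg_zero]
  have hneg : (Finset.univ.filter fun i => g i < 0).Nonempty := by
    by_contra hne
    rw [Finset.not_nonempty_iff_eq_empty, Finset.filter_eq_empty_iff] at hne
    have hge : ∀ i, 0 ≤ g i := fun i => not_lt.1 (hne (Finset.mem_univ i))
    have hs : ∑ i, g i * e (v i) = 0 := by simpa using congrArg e hg0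
    rw [Finset.sum_eq_zero_iff_of_nonneg fun i _ => mul_nonneg (hge i) (he i).le] at hs
    have := hs i0 (Finset.mem_univ _)
    exact (mul_ne_zero hgi0 (he i0).ne') this
  obtain ⟨k, hk, hmin⟩ := Finset.exists_min_image _ (fun i => c i / (-g i)) hneg
  have hgk : g k < 0 := by simpa using hk
  set t := c k / (-g k) with ht
  have ht0 : 0 ≤ t := div_nonneg (hc k) (by linarith)
  have hnew : ∀ i, 0 ≤ c i + t * g i := by
    intro i
    rcases lt_or_ge (g i) 0 with h | h
    · have := hmin i (by simpa using h)
      rw [le_div_iff₀ (by linarith)] at this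
      linarith
    · have := hc i; positivity
  have hck : c k ≠ 0 := fun h => hgk.ne (hgs k h)
  have hk0 : c k + t * g k = 0 := by
    have := hgk.ne
    rw [ht]; field_simp; ring
  obtain ⟨c', h1, h2, h3, h4⟩ := ih _ (by
      rw [← hn]
      apply Finset.card_lt_card
      refine (Finset.ssubset_iff_of_subset ?_).2 ⟨k, by simpa using hck, by simpa using hk0⟩
      intro i
      simp only [Finset.mem_filter, Finset.mem_univ, true_and]
      intro h h'
      exact h (by rw [h', hgs i h']; simp)) (fun i => c i + t * g i) hnew (by
        have : 0 ≤ t * g j := mul_nonneg ht0 hgj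
        linarith) rfl
  refine ⟨c', h1, h2.trans ?_, h3, h4⟩
  simp only [add_smul, Finset.sum_add_distrib, mul_smul, ← Finset.smul_sum, hg0, smul_zero,
    add_zero]

lemma exists_isBas_superset {v : J → E} (hspan : Submodule.span ℝ (Set.range v) = ⊤)
    {s : Set J} (hs : LinearIndepOn ℝ v s) : ∃ S : Finset J, s ⊆ S ∧ IsBas v S := by
  classical
  refine ⟨(hs.extend (Set.subset_univ s)).toFinset, ?_, ?_, ?_⟩
  · simpa using hs.subset_extend (Set.subset_univ s)
  · simpa using hs.linearIndepOn_extend (Set.subset_univ s)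
  · simpa [hspan] using hs.span_image_extend_eq_span_image (Set.subset_univ s)

/-- The basis of `E` attached to a basic index set. -/
def IsBas.basis {v : J → E} {S : Finset J} (h : IsBas v S) : Module.Basis S ℝ E :=
  Module.Basis.mk (v := fun i : S => v i) h.1 (by
    rw [← h.2, Set.image_eq_range]; rfl)

open Classical in
/-- The coordinate functional of index `i` with respect to the basis indexed by `S`. -/
def crd (v : J → E) (S : Finset J) (i : J) : E →ₗ[ℝ] ℝ :=
  if h : IsBas v S ∧ i ∈ S then h.1.basis.coord ⟨i, h.2⟩ else 0

lemma sum_crd {v : J → E} {S : Finset J} (h : IsBas v S) (x : E) :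
    ∑ i ∈ S, crd v S i x • v i = x := by
  conv_rhs => rw [← h.basis.sum_repr x]
  rw [← Finset.sum_coe_sort]
  refine Finset.sum_congr rfl fun i _ => ?_
  have : h.basis i = v i := by
    unfold IsBas.basis
    exact Module.Basis.mk_apply _ _ _
  simp [crd, h, this]

lemma crd_eq {v : J → E} {S : Finset J} (h : IsBas v S) {x : E} {c : J → ℝ}
    (hx : ∑ i ∈ S, c i • v i = x) {i : J} (hi : i ∈ S) : crd v S i x = c i := by
  have h0 : ∑ i ∈ S, (crd v S i x - c i) • v i = 0 := by
    simp [sub_smul, Finset.sum_sub_distrib, sum_crd h, hx]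
  have := linearIndepOn_finset_iff.1 h.1 _ h0 i hi
  linarith

lemma crd_self {v : J → E} {S : Finset J} (h : IsBas v S) {i : J} (hi : i ∈ S) :
    crd v S i (v i) = 1 := by
  classical
  refine (crd_eq h (c := fun j => if j = i then 1 else 0) ?_ hi).trans (by simp)
  simp [hi]

lemma exists_isBas_nonneg {v : J → E} {e : E →ₗ[ℝ] ℝ} (he : ∀ i, 0 < e (v i))
    (hspan : Submodule.span ℝ (Set.range v) = ⊤) {x : E} (hx : x ∈ coneHull v) :
    ∃ S, IsBas v S ∧ ∀ i ∈ S, 0 ≤ crd v S i x := by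
  classical
  obtain ⟨c, hc, rfl⟩ := hx
  obtain ⟨c', h1, h2, h3⟩ : ∃ c' : J → ℝ, (∀ i, 0 ≤ c' i) ∧
      ∑ i, c' i • v i = ∑ i, c i • v i ∧ LinearIndepOn ℝ v {i | c' i ≠ 0} := by
    by_cases h : ∃ j, 0 < c j
    · obtain ⟨j, hj⟩ := h
      obtain ⟨c', h1, h2, -, h3⟩ := exists_linearIndepOn_support he c hc j hj
      exact ⟨c', h1, h2, h3⟩
    · push Not at h
      have : c = 0 := funext fun i => le_antisymm (h i) (hc i)
      subst this
      exact ⟨0, fun _ => le_rfl, rfl, by simp [linearIndepOn_empty]⟩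
  obtain ⟨S, hS, hb⟩ := exists_isBas_superset hspan h3
  refine ⟨S, hb, fun i hi => ?_⟩
  rw [crd_eq hb (c := c') ?_ hi]
  · exact h1 i
  · rw [← h2]
    refine Finset.sum_subset (Finset.subset_univ _) fun i _ hi => ?_
    have : c' i = 0 := by
      by_contra h
      exact hi (hS h)
    simp [this]

lemma mem_coneHull_of_crd_nonneg {v : J → E} {S : Finset J} (h : IsBas v S) {x : E}
    (hx : ∀ i ∈ S, 0 ≤ crd v S i x) : x ∈ coneHull v := by
  rw [← sum_crd h x]
  exact sum_mem_coneHull _ _ fun i hi => coneHull_smul (hx i hi) (mem_coneHull v i)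

end

section

variable {E J : Type*} [AddCommGroup E] [Module ℝ E] [Fintype J]

/-- The linear functional which takes the value `ω i` at `v i` for each `i ∈ S`. -/
def lift (v : J → E) (ω : J → ℝ) (S : Finset J) : E →ₗ[ℝ] ℝ :=
  ∑ i ∈ S, ω i • crd v S i

lemma lift_apply (v : J → E) (ω : J → ℝ) (S : Finset J) (x : E) :
    lift v ω S x = ∑ i ∈ S, crd v S i x * ω i := by
  simp [lift, mul_comm]

lemma lift_eq {v : J → E} (ω : J → ℝ) {S : Finset J} (h : IsBas v S) {x : E} {c : J → ℝ}
    (hx : ∑ i ∈ S, c i • v i = x) : lift v ω S x = ∑ i ∈ S, c i * ω i := by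
  rw [lift_apply]
  exact Finset.sum_congr rfl fun i hi => by rw [crd_eq h hx hi]

lemma lift_self {v : J → E} (ω : J → ℝ) {S : Finset J} (h : IsBas v S) {i : J} (hi : i ∈ S) :
    lift v ω S (v i) = ω i := by
  classical
  rw [lift_eq ω h (c := fun j => if j = i then 1 else 0) (by simp [hi])]
  simp [hi]

/-- Heights for which no lifted point lies on the hyperplane spanned by a lifted basis not
containing it. -/
def GenericHeights (v : J → E) (ω : J → ℝ) : Prop :=
  ∀ S, IsBas v S → ∀ j ∉ S, lift v ω S (v j) ≠ ω j

lemma exists_genericHeights (v : J → E) : ∃ ω : J → ℝ, GenericHeights v ω := by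
  classical
  let f : {p : Finset J × J // IsBas v p.1 ∧ p.2 ∉ p.1} → Module.Dual ℝ (J → ℝ) := fun p =>
    (∑ i ∈ p.1.1, crd v p.1.1 i (v p.1.2) • LinearMap.proj i) - LinearMap.proj p.1.2
  obtain ⟨ω, hω⟩ := Module.Dual.exists_forall_ne_zero_of_forall_exists f (by
    rintro ⟨⟨S, j⟩, hS, hj⟩
    refine ⟨Pi.single j 1, ?_⟩
    simp only [f, LinearMap.sub_apply, LinearMap.sum_apply, LinearMap.smul_apply,
      LinearMap.proj_apply, smul_eq_mul]
    rw [Finset.sum_eq_zero]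
    · simp
    · intro i hi
      have : i ≠ j := fun h => hj (h ▸ hi)
      simp [this])
  refine ⟨ω, fun S hS j hj h => hω ⟨⟨S, j⟩, hS, hj⟩ ?_⟩
  rw [lift_apply] at h
  simp [f, h]

open Classical in
/-- The regular triangulation of the cone over `v` induced by the heights `ω`. -/
def triang (v : J → E) (ω : J → ℝ) : Finset (Finset J) :=
  Finset.univ.filter fun S => IsBas v S ∧ ∀ j ∉ S, lift v ω S (v j) < ω j

lemma mem_triang {v : J → E} {ω : J → ℝ} {S : Finset J} :
    S ∈ triang v ω ↔ IsBas v S ∧ ∀ j ∉ S, lift v ω S (v j) < ω j := by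
  simp [triang]

lemma triang_subset_of_pos {v : J → E} {ω : J → ℝ} {S S' : Finset J} (hS : S ∈ triang v ω)
    (hS' : S' ∈ triang v ω) {y : E} (hy : ∀ i ∈ S, 0 < crd v S i y)
    (hy' : ∀ i ∈ S', 0 < crd v S' i y) (hle : lift v ω S' y ≤ lift v ω S y) : S' ⊆ S := by
  rw [mem_triang] at hS hS'
  by_contra hn
  obtain ⟨j, hj', hj⟩ := Finset.not_subset.1 hn
  have h1 : lift v ω S y = ∑ i ∈ S', crd v S' i y * lift v ω S (v i) := by
    conv_lhs => rw [← sum_crd hS'.1 y]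
    simp
  have h2 : lift v ω S y < lift v ω S' y := by
    rw [h1, lift_apply]
    refine Finset.sum_lt_sum (fun i hi => ?_) ⟨j, hj', ?_⟩
    · refine mul_le_mul_of_nonneg_left ?_ (hy' i hi).le
      by_cases h : i ∈ S
      · exact (lift_self ω hS.1 h).le
      · exact (hS.2 i h).le
    · exact mul_lt_mul_of_pos_left (hS.2 j hj) (hy' j hj')
  linarith

lemma triang_unique {v : J → E} {ω : J → ℝ} {S S' : Finset J} (hS : S ∈ triang v ω)
    (hS' : S' ∈ triang v ω) {y : E} (hy : ∀ i ∈ S, 0 < crd v S i y)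
    (hy' : ∀ i ∈ S', 0 < crd v S' i y) : S = S' := by
  have hcard : S.card = S'.card := by
    have h1 := Module.finrank_eq_card_basis (mem_triang.1 hS).1.basis
    have h2 := Module.finrank_eq_card_basis (mem_triang.1 hS').1.basis
    simp only [Fintype.card_coe] at h1 h2
    omega
  rcases le_total (lift v ω S' y) (lift v ω S y) with h | h
  · exact (Finset.eq_of_subset_of_card_le (triang_subset_of_pos hS hS' hy hy' h) hcard.le).symm
  · exact Finset.eq_of_subset_of_card_le (triang_subset_of_pos hS' hS hy' hy h) hcard.ge

/-- Exchanging a basis element with a vector having a nonzero coordinate there. -/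
lemma IsBas.exchange [DecidableEq J] {v : J → E} {S : Finset J} (h : IsBas v S) {k j : J}
    (hk : k ∈ S) (hj : j ∉ S) (hkj : crd v S k (v j) ≠ 0) : IsBas v (insert j (S.erase k)) := by
  have hje : j ∉ S.erase k := fun h' => hj (Finset.mem_of_mem_erase h')
  constructor
  · rw [linearIndepOn_finset_iff]
    intro f hf
    rw [Finset.sum_insert hje] at hf
    have hk0 : f j = 0 := by
      have := congrArg (crd v S k) hf
      simp only [map_add, map_smul, map_sum, smul_eq_mul, map_zero] at this
      rw [Finset.sum_eq_zero] at this
      · simpa [hkj] using this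
      · intro i hi
        rw [crd_eq h (x := v i) (c := fun l => if l = i then 1 else 0)
          (by simp [Finset.mem_of_mem_erase hi]) hk]
        simp [(Finset.ne_of_mem_erase hi).symm]
    rw [hk0, zero_smul, zero_add] at hf
    have hli := linearIndepOn_finset_iff.1 (h.1.mono
      (Finset.coe_subset.2 (Finset.erase_subset k S))) f hf
    intro i hi
    rcases Finset.mem_insert.1 hi with rfl | hi
    · exact hk0
    · exact hli i hi
  · rw [eq_top_iff, ← h.2, Submodule.span_le]
    have hmem : ∀ i ∈ S, i ≠ k →
        v i ∈ Submodule.span ℝ (v '' ((insert j (S.erase k) : Finset J) : Set J)) := fun i hi hik =>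
      Submodule.subset_span ⟨i, by simp [hi, hik], rfl⟩
    rintro _ ⟨i, hi, rfl⟩
    by_cases hik : i = k
    · subst hik
      have h1 : crd v S i (v j) • v i = v j - ∑ l ∈ S.erase i, crd v S l (v j) • v l := by
        rw [eq_sub_iff_add_eq, Finset.add_sum_erase S (fun l => crd v S l (v j) • v l) hi,
          sum_crd h]
      have h2 : v i = (crd v S i (v j))⁻¹ • (v j - ∑ l ∈ S.erase i, crd v S l (v j) • v l) := by
        rw [← h1, smul_smul, inv_mul_cancel₀ hkj, one_smul]
      rw [h2]
      refine Submodule.smul_mem _ _ (Submodule.sub_mem _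
        (Submodule.subset_span ⟨j, by simp, rfl⟩) (Submodule.sum_mem _ fun l hl => ?_))
      exact Submodule.smul_mem _ _
        (hmem l (Finset.mem_of_mem_erase hl) (Finset.ne_of_mem_erase hl))
    · exact hmem i hi hik

lemma triang_exists {v : J → E} {ω : J → ℝ} {e : E →ₗ[ℝ] ℝ} (he : ∀ i, 0 < e (v i))
    (hspan : Submodule.span ℝ (Set.range v) = ⊤) (hω : GenericHeights v ω) {y : E}
    (hy : y ∈ coneHull v) (hgen : ∀ S, IsBas v S → ∀ i ∈ S, crd v S i y ≠ 0) :
    ∃ S ∈ triang v ω, ∀ i ∈ S, 0 < crd v S i y := by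
  classical
  obtain ⟨S0, hb0, hS0⟩ := exists_isBas_nonneg he hspan hy
  obtain ⟨S, hS, hmin⟩ := Finset.exists_min_image
    (Finset.univ.filter fun S => IsBas v S ∧ ∀ i ∈ S, 0 ≤ crd v S i y) (fun S => lift v ω S y)
    ⟨S0, by simpa using ⟨hb0, hS0⟩⟩
  simp only [Finset.mem_filter, Finset.mem_univ, true_and] at hS hmin
  obtain ⟨hb, hnn⟩ := hS
  have hpos : ∀ i ∈ S, 0 < crd v S i y := fun i hi => (hnn i hi).lt_of_ne (hgen S hb i hi).symm
  refine ⟨S, mem_triang.2 ⟨hb, fun j hj => ?_⟩, hpos⟩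
  by_contra hlt
  have hgt : ω j < lift v ω S (v j) := (not_lt.1 hlt).lt_of_ne (hω S hb j hj).symm
  have hne : (S.filter fun i => 0 < crd v S i (v j)).Nonempty := by
    by_contra hne
    rw [Finset.not_nonempty_iff_eq_empty, Finset.filter_eq_empty_iff] at hne
    have h1 : e (v j) = ∑ i ∈ S, crd v S i (v j) * e (v i) := by
      conv_lhs => rw [← sum_crd hb (v j)]
      simp
    have h2 : e (v j) ≤ 0 := by
      rw [h1]
      exact Finset.sum_nonpos fun i hi =>
        mul_nonpos_of_nonpos_of_nonneg (not_lt.1 (hne hi)) (he i).le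
    linarith [he j]
  obtain ⟨k, hk, hkmin⟩ := Finset.exists_min_image _
    (fun i => crd v S i y / crd v S i (v j)) hne
  obtain ⟨hkS, hkpos⟩ := Finset.mem_filter.1 hk
  set θ := crd v S k y / crd v S k (v j) with hθ
  have hθpos : 0 < θ := div_pos (hpos k hkS) hkpos
  have hb' := hb.exchange hkS hj hkpos.ne'
  have hje : j ∉ S.erase k := fun h' => hj (Finset.mem_of_mem_erase h')
  let c : J → ℝ := fun i => if i = j then θ else crd v S i y - θ * crd v S i (v j)
  have hck : crd v S k y - θ * crd v S k (v j) = 0 := by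
    rw [hθ]; field_simp; ring
  have hcS : ∀ g : J → E × ℝ, ∑ i ∈ insert j (S.erase k), c i • g i =
        θ • g j + (∑ i ∈ S, crd v S i y • g i - θ • ∑ i ∈ S, crd v S i (v j) • g i) := by
    intro g
    rw [Finset.sum_insert hje]
    congr 1
    · simp [c]
    · have : ∑ i ∈ S.erase k, c i • g i =
          ∑ i ∈ S, (crd v S i y - θ * crd v S i (v j)) • g i := by
        rw [← Finset.add_sum_erase S _ hkS, hck, zero_smul, zero_add]
        refine Finset.sum_congr rfl fun i hi => ?_
        have : i ≠ j := fun h => hje (h ▸ hi)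
        simp [c, this]
      rw [this]
      simp [sub_smul, mul_smul, Finset.smul_sum]
  have hcy : ∑ i ∈ insert j (S.erase k), c i • v i = y := by
    have h := congrArg Prod.fst (hcS fun i => (v i, 0))
    simp only [Prod.fst_sum, Prod.fst_add, Prod.fst_sub, Prod.smul_fst] at h
    rw [h, sum_crd hb, sum_crd hb]; abel
  have hcnn : ∀ i ∈ insert j (S.erase k), 0 ≤ c i := by
    intro i hi
    by_cases hij : i = j
    · simp [c, hij, hθpos.le]
    · have hiS : i ∈ S := Finset.mem_of_mem_erase ((Finset.mem_insert.1 hi).resolve_left hij)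
      simp only [c, if_neg hij]
      rcases lt_or_ge 0 (crd v S i (v j)) with h | h
      · have := hkmin i (Finset.mem_filter.2 ⟨hiS, h⟩)
        rw [le_div_iff₀ h] at this
        linarith
      · have := hnn i hiS
        nlinarith
  have hle := hmin _ ⟨hb', fun i hi => by rw [crd_eq hb' hcy hi]; exact hcnn i hi⟩
  rw [lift_eq ω hb' hcy] at hle
  have h3 := congrArg Prod.snd (hcS fun i => (0, ω i))
  simp only [Prod.snd_sum, Prod.snd_add, Prod.snd_sub, Prod.smul_snd, smul_eq_mul] at h3
  rw [h3, ← lift_apply, ← lift_apply] at hle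
  nlinarith

/-- A half-open simplicial cone: the coordinates are nonnegative, and positive at the indices
where `p` holds. -/
def HalfOpen (v : J → E) (S : Finset J) (p : J → Prop) (x : E) : Prop :=
  ∀ i ∈ S, 0 ≤ crd v S i x ∧ (p i → 0 < crd v S i x)

/-- A vector avoiding all hyperplanes spanned by members of the family. -/
def GenericVec (v : J → E) (ζ : E) : Prop := ∀ S, IsBas v S → ∀ i ∈ S, crd v S i ζ ≠ 0

lemma GenericVec.neg {v : J → E} {ζ : E} (h : GenericVec v ζ) : GenericVec v (-ζ) :=
  fun S hS i hi => by simpa using h S hS i hi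

lemma eventually_pos_iff {a b : ℝ} (hb : b ≠ 0) : ∀ᶠ ε in 𝓝[>] (0 : ℝ),
    a + ε * b ≠ 0 ∧ (0 < a + ε * b ↔ 0 ≤ a ∧ (b < 0 → 0 < a)) := by
  have hcont : Tendsto (fun ε : ℝ => a + ε * b) (𝓝[>] 0) (𝓝 a) := by
    have : Tendsto (fun ε : ℝ => a + ε * b) (𝓝 0) (𝓝 (a + 0 * b)) :=
      Continuous.tendsto (by fun_prop) 0
    simpa using this.mono_left nhdsWithin_le_nhds
  rcases lt_trichotomy a 0 with ha | rfl | ha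
  · filter_upwards [hcont.eventually_lt_const ha] with ε hε
    exact ⟨hε.ne, fun h => absurd h (by linarith), fun h => absurd h.1 (by linarith)⟩
  · filter_upwards [self_mem_nhdsWithin] with ε hε
    have hε : 0 < ε := hε
    rcases lt_or_gt_of_ne hb with h | h
    · refine ⟨by simp [hε.ne', hb], fun h' => ?_, fun h' => absurd (h'.2 h) (lt_irrefl _)⟩
      nlinarith
    · exact ⟨by simp [hε.ne', hb], fun _ => ⟨le_rfl, fun h' => absurd h' h.not_gt⟩,
        fun _ => by positivity⟩
  · filter_upwards [hcont.eventually_const_lt ha] with ε hε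
    exact ⟨hε.ne', fun _ => ⟨ha.le, fun _ => ha⟩, fun _ => hε⟩

lemma eventually_halfOpen_iff {v : J → E} {ζ : E} (hζ : GenericVec v ζ) (x : E) :
    ∀ᶠ ε in 𝓝[>] (0 : ℝ), ∀ S, IsBas v S → (∀ i ∈ S, crd v S i (x + ε • ζ) ≠ 0) ∧
      ((∀ i ∈ S, 0 < crd v S i (x + ε • ζ)) ↔ HalfOpen v S (fun i => crd v S i ζ < 0) x) := by
  rw [eventually_all]
  intro S
  by_cases hS : IsBas v S
  · have : ∀ᶠ ε in 𝓝[>] (0 : ℝ), ∀ i : S, crd v S i x + ε * crd v S i ζ ≠ 0 ∧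
        (0 < crd v S i x + ε * crd v S i ζ ↔
          0 ≤ crd v S i x ∧ (crd v S i ζ < 0 → 0 < crd v S i x)) := by
      rw [eventually_all]
      exact fun i => eventually_pos_iff (hζ S hS i i.2)
    filter_upwards [this] with ε hε _
    simp only [map_add, map_smul, smul_eq_mul]
    exact ⟨fun i hi => (hε ⟨i, hi⟩).1, forall₂_congr fun i hi => (hε ⟨i, hi⟩).2⟩
  · exact Eventually.of_forall fun ε h => absurd h hS

lemma eventually_mem_coneHull_iff {v : J → E} {ω : J → ℝ} {e : E →ₗ[ℝ] ℝ}
    (he : ∀ i, 0 < e (v i)) (hspan : Submodule.span ℝ (Set.range v) = ⊤)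
    (hω : GenericHeights v ω) {ζ : E} (hζ : GenericVec v ζ) (x : E) :
    (∀ᶠ ε in 𝓝[>] (0 : ℝ), x + ε • ζ ∈ coneHull v) ↔
      ∃ S ∈ triang v ω, HalfOpen v S (fun i => crd v S i ζ < 0) x := by
  constructor
  · intro h
    obtain ⟨ε, h1, h2⟩ := (h.and (eventually_halfOpen_iff hζ x)).exists
    obtain ⟨S, hS, hpos⟩ := triang_exists he hspan hω h1 fun S hS => (h2 S hS).1
    exact ⟨S, hS, (h2 S (mem_triang.1 hS).1).2.1 hpos⟩
  · rintro ⟨S, hS, hx⟩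
    filter_upwards [eventually_halfOpen_iff hζ x] with ε hε
    have hb := (mem_triang.1 hS).1
    exact mem_coneHull_of_crd_nonneg hb fun i hi => ((hε S hb).2.2 hx i hi).le

lemma halfOpen_unique {v : J → E} {ω : J → ℝ} {ζ : E} (hζ : GenericVec v ζ) {x : E}
    {S S' : Finset J} (hS : S ∈ triang v ω) (hS' : S' ∈ triang v ω)
    (h : HalfOpen v S (fun i => crd v S i ζ < 0) x)
    (h' : HalfOpen v S' (fun i => crd v S' i ζ < 0) x) : S = S' := by
  obtain ⟨ε, h2⟩ := (eventually_halfOpen_iff hζ x).exists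
  exact triang_unique hS hS' ((h2 S (mem_triang.1 hS).1).2.2 h)
    ((h2 S' (mem_triang.1 hS').1).2.2 h')

/-- `ξ` is an algebraic interior point of the cone. -/
def IsInner (v : J → E) (ξ : E) : Prop := ∀ x : E, ∃ δ > 0, ξ + (δ : ℝ) • x ∈ coneHull v

lemma isInner_sum {v : J → E} (hspan : Submodule.span ℝ (Set.range v) = ⊤) :
    IsInner v (∑ i, v i) := by
  intro x
  have hx : x ∈ Submodule.span ℝ (Set.range v) := hspan ▸ Submodule.mem_top
  rw [Submodule.mem_span_range_iff_exists_fun] at hx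
  obtain ⟨c, rfl⟩ := hx
  have h : ∀ᶠ δ in 𝓝[>] (0 : ℝ), ∀ i, 0 ≤ 1 + δ * c i := by
    rw [eventually_all]
    intro i
    have : Tendsto (fun ε : ℝ => 1 + ε * c i) (𝓝 0) (𝓝 (1 + 0 * c i)) :=
      Continuous.tendsto (by fun_prop) 0
    rw [zero_mul, add_zero] at this
    filter_upwards [(this.mono_left nhdsWithin_le_nhds).eventually_const_lt zero_lt_one] with ε h
    exact h.le
  obtain ⟨δ, h1, h2⟩ := (h.and self_mem_nhdsWithin).exists
  refine ⟨δ, h2, fun i => 1 + δ * c i, h1, ?_⟩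
  simp [add_smul, Finset.sum_add_distrib, Finset.smul_sum, mul_smul]

lemma exists_genericVec (v : J → E) : ∃ ζ, GenericVec v ζ := by
  classical
  let f : {p : Finset J × J // IsBas v p.1 ∧ p.2 ∈ p.1} → Module.Dual ℝ E := fun p =>
    crd v p.1.1 p.1.2
  obtain ⟨ζ, hζ⟩ := Module.Dual.exists_forall_ne_zero_of_forall_exists f (by
    rintro ⟨⟨S, j⟩, hS, hj⟩
    exact ⟨v j, by simp [f, crd_self hS hj]⟩)
  exact ⟨ζ, fun S hS i hi => hζ ⟨⟨S, i⟩, hS, hi⟩⟩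

lemma exists_generic_isInner {v : J → E} (hspan : Submodule.span ℝ (Set.range v) = ⊤) :
    ∃ ξ, GenericVec v ξ ∧ IsInner v ξ ∧ ξ ∈ coneHull v := by
  obtain ⟨ζ, hζ⟩ := exists_genericVec v
  obtain ⟨δ, hδ, hmem⟩ := isInner_sum hspan ζ
  have h := (eventually_halfOpen_iff hζ (∑ i, v i)).and
    (Ioo_mem_nhdsGT (show (0 : ℝ) < δ / 2 by linarith))
  obtain ⟨t, h1, ht0, htδ⟩ := h.exists
  have hsum : ∑ i, v i ∈ coneHull v := sum_mem_coneHull _ _ fun i _ => mem_coneHull v i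
  have hin : IsInner v (∑ i, v i + t • ζ) := by
    intro x
    obtain ⟨η, hη, hx⟩ := isInner_sum hspan x
    refine ⟨(1 - t / δ) * η, mul_pos ?_ hη, ?_⟩
    · rw [sub_pos, div_lt_one hδ]; linarith
    · have e1 : ∑ i, v i + t • ζ + ((1 - t / δ) * η) • x =
          (1 - t / δ) • (∑ i, v i + η • x) + (t / δ) • (∑ i, v i + δ • ζ) := by
        have : (t / δ * δ) = t := by field_simp
        simp only [smul_add, smul_smul, this]
        module
      rw [e1]
      refine coneHull_add (coneHull_smul ?_ hx) (coneHull_smul (by positivity) hmem)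
      rw [sub_nonneg, div_le_one hδ]; linarith
  refine ⟨∑ i, v i + t • ζ, fun S hS i hi => (h1 S hS).1 i hi, hin, ?_⟩
  obtain ⟨η, hη, h0⟩ := hin 0
  simpa using h0

lemma eventually_add_mem_iff {v : J → E} {ω : J → ℝ} {e : E →ₗ[ℝ] ℝ}
    (he : ∀ i, 0 < e (v i)) (hspan : Submodule.span ℝ (Set.range v) = ⊤)
    (hω : GenericHeights v ω) {ξ : E} (hξ : GenericVec v ξ) (hξC : ξ ∈ coneHull v) (x : E) :
    x ∈ coneHull v ↔ ∃ S ∈ triang v ω, HalfOpen v S (fun i => crd v S i ξ < 0) x := by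
  rw [← eventually_mem_coneHull_iff he hspan hω hξ]
  constructor
  · intro hx
    filter_upwards [self_mem_nhdsWithin] with ε hε
    exact coneHull_add hx (coneHull_smul (le_of_lt hε) hξC)
  · intro h
    obtain ⟨S, hS, hx⟩ := (eventually_mem_coneHull_iff he hspan hω hξ x).1 h
    exact mem_coneHull_of_crd_nonneg (mem_triang.1 hS).1 fun i hi => (hx i hi).1

/-- The points of the cone from which one can move a little in the direction `-ξ`. -/
def innerCone (v : J → E) (ξ : E) : Set E := {x | ∃ ε > 0, x - (ε : ℝ) • ξ ∈ coneHull v}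

lemma mem_innerCone_iff {v : J → E} {ω : J → ℝ} {e : E →ₗ[ℝ] ℝ}
    (he : ∀ i, 0 < e (v i)) (hspan : Submodule.span ℝ (Set.range v) = ⊤)
    (hω : GenericHeights v ω) {ξ : E} (hξ : GenericVec v ξ) (hξC : ξ ∈ coneHull v) (x : E) :
    x ∈ innerCone v ξ ↔ ∃ S ∈ triang v ω, HalfOpen v S (fun i => crd v S i (-ξ) < 0) x := by
  rw [← eventually_mem_coneHull_iff he hspan hω hξ.neg]
  constructor
  · rintro ⟨ε, hε, hx⟩
    filter_upwards [Ioo_mem_nhdsGT hε] with δ hδ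
    have : x + δ • -ξ = (x - ε • ξ) + (ε - δ) • ξ := by module
    rw [this]
    exact coneHull_add hx (coneHull_smul (by linarith [hδ.2]) hξC)
  · intro h
    obtain ⟨ε, h1, h2⟩ := (h.and self_mem_nhdsWithin).exists
    exact ⟨ε, h2, by simpa [sub_eq_add_neg] using h1⟩

end

section

/-- The lattice of integral vectors. -/
def lat (N : ℕ) : AddSubgroup (Fin N → ℝ) where
  carrier := {x | IsLatticePoint x}
  zero_mem' := fun _ => ⟨0, by simp⟩
  add_mem' := fun ha hb i => by
    obtain ⟨z, hz⟩ := ha i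
    obtain ⟨w, hw⟩ := hb i
    exact ⟨z + w, by simp [hz, hw]⟩
  neg_mem' := fun ha i => by
    obtain ⟨z, hz⟩ := ha i
    exact ⟨-z, by simp [hz]⟩

lemma intCast_mem_lat {N : ℕ} (z : Fin N → ℤ) : (fun i => (z i : ℝ)) ∈ lat N :=
  fun i => ⟨z i, rfl⟩

lemma mem_lat_iff_exists {N : ℕ} {x : Fin N → ℝ} :
    x ∈ lat N ↔ ∃ z : Fin N → ℤ, (fun i => (z i : ℝ)) = x := by
  constructor
  · intro h
    choose z hz using h
    exact ⟨z, funext fun i => (hz i).symm⟩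
  · rintro ⟨z, rfl⟩
    exact intCast_mem_lat z

lemma intSmul_mem_lat {N : ℕ} {x : Fin N → ℝ} (hx : x ∈ lat N) (k : ℤ) :
    (k : ℝ) • x ∈ lat N := by
  rw [Int.cast_smul_eq_zsmul]
  exact (lat N).zsmul_mem hx k

lemma natSmul_mem_lat {N : ℕ} {x : Fin N → ℝ} (hx : x ∈ lat N) (k : ℕ) :
    (k : ℝ) • x ∈ lat N := by
  exact_mod_cast intSmul_mem_lat hx k

lemma exists_int_dotProduct {N : ℕ} {x y : Fin N → ℝ} (hx : x ∈ lat N) (hy : y ∈ lat N) :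
    ∃ z : ℤ, x ⬝ᵥ y = z := by
  obtain ⟨a, rfl⟩ := mem_lat_iff_exists.1 hx
  obtain ⟨b, rfl⟩ := mem_lat_iff_exists.1 hy
  exact ⟨∑ i, a i * b i, by simp [dotProduct]⟩

lemma finite_lat_of_bounded {N : ℕ} (B : ℝ) {s : Set (Fin N → ℝ)}
    (hs : ∀ x ∈ s, x ∈ lat N ∧ ∀ i, |x i| ≤ B) : s.Finite := by
  have hf : (Set.univ.pi fun _ : Fin N => (Set.Icc (-⌈B⌉) ⌈B⌉ : Set ℤ)).Finite :=
    Set.Finite.pi fun _ => Set.finite_Icc _ _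
  refine (hf.image fun z i => (z i : ℝ)).subset ?_
  intro x hx
  obtain ⟨hl, hb⟩ := hs x hx
  obtain ⟨z, rfl⟩ := mem_lat_iff_exists.1 hl
  refine ⟨z, fun i _ => ?_, rfl⟩
  have h1 : |(z i : ℝ)| ≤ ⌈B⌉ := (hb i).trans (Int.le_ceil B)
  have h2 : |z i| ≤ ⌈B⌉ := by exact_mod_cast h1
  exact abs_le.1 h2

lemma card_piAntidiag {ι : Type*} [DecidableEq ι] (s : Finset ι) (m : ℕ) :
    (s.piAntidiag m).card = (s.card + m - 1).choose m := by
  rw [← Finset.card_finsuppAntidiag_nat_eq_choose]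
  refine (Finset.card_nbij (fun f : ι →₀ ℕ => (f : ι → ℕ)) ?_ ?_ ?_).symm
  · intro f hf
    rw [Finset.mem_coe, Finset.mem_finsuppAntidiag] at hf
    rw [Finset.mem_coe, Finset.mem_piAntidiag]
    exact ⟨hf.1, fun i hi => hf.2 (Finsupp.mem_support_iff.2 hi)⟩
  · exact DFunLike.coe_injective.injOn
  · intro f hf
    rw [Finset.mem_coe, Finset.mem_piAntidiag] at hf
    refine ⟨Finsupp.onFinset s f hf.2, ?_, rfl⟩
    rw [Finset.mem_coe, Finset.mem_finsuppAntidiag]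
    exact ⟨hf.1, Finsupp.support_onFinset_subset⟩

/-- The number of monomials of degree `m - j` in `n + 1` variables. -/
def monoCount (n m j : ℕ) : ℕ := if j ≤ m then (n + (m - j)).choose n else 0

lemma monoCount_self (n m : ℕ) : monoCount n m m = 1 := by simp [monoCount]

lemma monoCount_of_lt {n m j : ℕ} (h : m < j) : monoCount n m j = 0 := by
  simp [monoCount, h.not_ge]

lemma monoCount_eq {n m j : ℕ} (h : j ≤ n) : monoCount n m j = (n + m - j).choose n := by
  unfold monoCount
  split_ifs with h'
  · congr 1; omega
  · exact (Nat.choose_eq_zero_of_lt (by omega)).symm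

lemma monoCount_add (n m j r : ℕ) : monoCount n (m + r) (j + r) = monoCount n m j := by
  simp [monoCount, Nat.add_sub_add_right]

variable {n : ℕ} {J : Type*} [Fintype J]

/-- The lattice points in the half-open fundamental parallelepiped of a simplicial cone. -/
def box (v : J → Fin (n + 1) → ℝ) (S : Finset J) (p : J → Prop) : Set (Fin (n + 1) → ℝ) :=
  {x | x ∈ lat (n + 1) ∧ ∀ i ∈ S, 0 ≤ crd v S i x ∧ crd v S i x ≤ 1 ∧ (p i → 0 < crd v S i x) ∧
    (¬ p i → crd v S i x < 1)}

lemma finite_box {v : J → Fin (n + 1) → ℝ} {S : Finset J} (hS : IsBas v S) (p : J → Prop) :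
    (box v S p).Finite := by
  refine finite_lat_of_bounded (∑ k, ∑ i ∈ S, |v i k|) fun x hx => ⟨hx.1, fun k => ?_⟩
  refine le_trans ?_ (Finset.single_le_sum (f := fun k => ∑ i ∈ S, |v i k|)
    (fun k _ => Finset.sum_nonneg fun i _ => abs_nonneg _) (Finset.mem_univ k))
  conv_lhs => rw [← sum_crd hS x, Finset.sum_apply]
  refine (Finset.abs_sum_le_sum_abs _ _).trans (Finset.sum_le_sum fun i hi => ?_)
  obtain ⟨h0, h1, -⟩ := hx.2 i hi
  rw [Pi.smul_apply, smul_eq_mul, abs_mul, abs_of_nonneg h0]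
  exact mul_le_of_le_one_left (abs_nonneg _) h1

lemma height_eq_sum_crd {v : J → Fin (n + 1) → ℝ} (hv0 : ∀ i, v i 0 = 1) {S : Finset J}
    (hS : IsBas v S) (x : Fin (n + 1) → ℝ) : x 0 = ∑ i ∈ S, crd v S i x := by
  conv_lhs => rw [← sum_crd hS x, Finset.sum_apply]
  simp [hv0]

lemma IsBas.card_eq {v : J → Fin (n + 1) → ℝ} {S : Finset J} (hS : IsBas v S) :
    S.card = n + 1 := by
  have h1 := Module.finrank_eq_card_basis hS.basis
  simpa using h1.symm

lemma crd_natSum {v : J → Fin (n + 1) → ℝ} {S : Finset J} (hS : IsBas v S)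
    (c : J → ℝ) {i : J} (hi : i ∈ S) : crd v S i (∑ j ∈ S, c j • v j) = c i :=
  crd_eq hS rfl hi

open Classical in
/-- The boxes of all simplices of the triangulation. -/
def boxes (v : J → Fin (n + 1) → ℝ) (ω : J → ℝ) (p : Finset J → J → Prop) :
    Finset (Σ _ : Finset J, Fin (n + 1) → ℝ) :=
  (triang v ω).sigma fun S => if h : IsBas v S then (finite_box h (p S)).toFinset else ∅

lemma mem_boxes {v : J → Fin (n + 1) → ℝ} {ω : J → ℝ} {p : Finset J → J → Prop}
    {b : Σ _ : Finset J, Fin (n + 1) → ℝ} :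
    b ∈ boxes v ω p ↔ b.1 ∈ triang v ω ∧ b.2 ∈ box v b.1 (p b.1) := by
  rw [boxes, Finset.mem_sigma]
  refine and_congr_right fun h => ?_
  rw [dif_pos (mem_triang.1 h).1, Set.Finite.mem_toFinset]

lemma exists_nat_height {v : J → Fin (n + 1) → ℝ} (hv0 : ∀ i, v i 0 = 1) {S : Finset J}
    (hS : IsBas v S) {x : Fin (n + 1) → ℝ} (hx : x ∈ lat (n + 1))
    (h : ∀ i ∈ S, 0 ≤ crd v S i x) : x 0 = (⌊x 0⌋₊ : ℝ) := by
  obtain ⟨z, hz⟩ := hx 0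
  have h0 : 0 ≤ x 0 := by
    rw [height_eq_sum_crd hv0 hS x]
    exact Finset.sum_nonneg h
  rw [hz] at h0 ⊢
  lift z to ℕ using (by exact_mod_cast h0)
  simp

/-- Counting the lattice points of a cone decomposed into half-open simplicial cones. -/
lemma slice_count {v : J → Fin (n + 1) → ℝ} {ω : J → ℝ} (hv : ∀ i, v i ∈ lat (n + 1))
    (hv0 : ∀ i, v i 0 = 1) {C : Set (Fin (n + 1) → ℝ)} {p : Finset J → J → Prop}
    (hC : ∀ x, x ∈ C ↔ ∃ S ∈ triang v ω, HalfOpen v S (p S) x)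
    (hu : ∀ x, ∀ S ∈ triang v ω, ∀ S' ∈ triang v ω, HalfOpen v S (p S) x →
      HalfOpen v S' (p S') x → S = S') (m : ℕ) :
    {x | x ∈ lat (n + 1) ∧ x ∈ C ∧ x 0 = m}.Finite ∧
    {x | x ∈ lat (n + 1) ∧ x ∈ C ∧ x 0 = m}.ncard =
      ∑ b ∈ boxes v ω p, monoCount n m ⌊b.2 0⌋₊ := by
  classical
  let T := (boxes v ω p).sigma fun b =>
    if ⌊b.2 0⌋₊ ≤ m then b.1.piAntidiag (m - ⌊b.2 0⌋₊) else ∅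
  let F : (Σ _ : (Σ _ : Finset J, Fin (n + 1) → ℝ), J → ℕ) → Fin (n + 1) → ℝ := fun t =>
    t.1.2 + ∑ i ∈ t.1.1, (t.2 i : ℝ) • v i
  have hT : ∀ t, t ∈ T ↔ (t.1.1 ∈ triang v ω ∧ t.1.2 ∈ box v t.1.1 (p t.1.1)) ∧
      ⌊t.1.2 0⌋₊ ≤ m ∧ ∑ i ∈ t.1.1, t.2 i = m - ⌊t.1.2 0⌋₊ ∧ ∀ i, t.2 i ≠ 0 → i ∈ t.1.1 := by
    intro t
    simp only [T, Finset.mem_sigma, mem_boxes]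
    refine and_congr_right fun _ => ?_
    split_ifs with h
    · simp [h, Finset.mem_piAntidiag]
    · simp [h]
  have hcrd : ∀ t ∈ T, ∀ i ∈ t.1.1, crd v t.1.1 i (F t) = crd v t.1.1 i t.1.2 + t.2 i := by
    intro t ht i hi
    simp only [F]
    rw [map_add, crd_natSum (mem_triang.1 ((hT t).1 ht).1.1).1 _ hi]
  have hho : ∀ t ∈ T, HalfOpen v t.1.1 (p t.1.1) (F t) := by
    intro t ht i hi
    rw [hcrd t ht i hi]
    obtain ⟨h0, -, h1, -⟩ := ((hT t).1 ht).1.2.2 i hi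
    exact ⟨by positivity, fun h => add_pos_of_pos_of_nonneg (h1 h) (by positivity)⟩
  have himg : {x | x ∈ lat (n + 1) ∧ x ∈ C ∧ x 0 = m} = F '' (T : Set _) := by
    ext x
    constructor
    · rintro ⟨hx, hxC, hxm⟩
      obtain ⟨S, hS, hH⟩ := (hC x).1 hxC
      have hb := (mem_triang.1 hS).1
      -- integer parts of the coordinates
      have hk : ∀ i, ∃ k : ℕ, (i ∉ S → k = 0) ∧ (i ∈ S → 0 ≤ crd v S i x - k ∧
          crd v S i x - k ≤ 1 ∧ (p S i → 0 < crd v S i x - k) ∧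
          (¬ p S i → crd v S i x - k < 1)) := by
        intro i
        by_cases hi : i ∈ S
        · obtain ⟨h0, h1⟩ := hH i hi
          by_cases hp : p S i
          · have h2 := h1 hp
            refine ⟨⌈crd v S i x⌉₊ - 1, fun h => absurd hi h, fun _ => ?_⟩
            have h3 : 1 ≤ ⌈crd v S i x⌉₊ := Nat.one_le_iff_ne_zero.2 (Nat.ceil_pos.2 h2).ne'
            have h4 := Nat.ceil_lt_add_one h0
            have h5 := Nat.le_ceil (crd v S i x)
            push_cast [Nat.cast_sub h3]
            exact ⟨by linarith, by linarith, fun _ => by linarith, fun h => absurd hp h⟩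
          · refine ⟨⌊crd v S i x⌋₊, fun h => absurd hi h, fun _ => ?_⟩
            have h4 := Nat.floor_le h0
            have h5 := Nat.lt_floor_add_one (crd v S i x)
            exact ⟨by linarith, by linarith, fun h => absurd h hp, fun _ => by linarith⟩
        · exact ⟨0, fun _ => rfl, fun h => absurd h hi⟩
      choose k hk0 hk using hk
      set b := x - ∑ i ∈ S, (k i : ℝ) • v i with hbdef
      have hbl : b ∈ lat (n + 1) := (lat _).sub_mem hx
        ((lat _).sum_mem fun i _ => natSmul_mem_lat (hv i) _)
      have hbc : ∀ i ∈ S, crd v S i b = crd v S i x - k i := by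
        intro i hi
        rw [hbdef, map_sub, crd_natSum hb _ hi]
      have hbb : b ∈ box v S (p S) := ⟨hbl, fun i hi => by rw [hbc i hi]; exact hk i hi⟩
      have hb0 := exists_nat_height hv0 hb hbl fun i hi => (hbb.2 i hi).1
      have hsum : ⌊b 0⌋₊ + ∑ i ∈ S, k i = m := by
        have : (x - ∑ i ∈ S, (k i : ℝ) • v i) 0 = m - ∑ i ∈ S, (k i : ℝ) := by
          simp [Finset.sum_apply, hv0, hxm]
        rw [← hbdef, hb0] at this
        have h2 : (⌊b 0⌋₊ + ∑ i ∈ S, k i : ℝ) = m := by push_cast; rw [this]; ring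
        exact_mod_cast h2
      refine ⟨⟨⟨S, b⟩, k⟩, ?_, by simp [F, hbdef]⟩
      rw [Finset.mem_coe, hT]
      refine ⟨⟨hS, hbb⟩, by simp only; omega, by simp only; omega, fun i hi => ?_⟩
      by_contra h
      exact hi (hk0 i h)
    · rintro ⟨t, ht, rfl⟩
      have ht : t ∈ T := ht
      obtain ⟨⟨h1, h2⟩, h3, h4, h5⟩ := (hT t).1 ht
      refine ⟨(lat _).add_mem h2.1 ((lat _).sum_mem fun i _ => natSmul_mem_lat (hv i) _),
        (hC _).2 ⟨_, h1, hho t ht⟩, ?_⟩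
      have hb0 := exists_nat_height hv0 (mem_triang.1 h1).1 h2.1 fun i hi => (h2.2 i hi).1
      have h6 : (∑ i ∈ t.1.1, (t.2 i : ℝ)) = m - (⌊t.1.2 0⌋₊ : ℝ) := by
        rw [← Nat.cast_sum, h4, Nat.cast_sub h3]
      simp only [F, Pi.add_apply, Finset.sum_apply, Pi.smul_apply, hv0, smul_eq_mul, mul_one]
      rw [h6, ← hb0]; ring
  have hinj : Set.InjOn F T := by
    rintro ⟨⟨S, b⟩, k⟩ ht ⟨⟨S', b'⟩, k'⟩ ht' heq
    have ht : _ ∈ T := ht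
    have ht' : _ ∈ T := ht'
    obtain ⟨⟨h1, h2⟩, -, -, h5⟩ := (hT _).1 ht
    obtain ⟨⟨h1', h2'⟩, -, -, h5'⟩ := (hT _).1 ht'
    have hH := hho _ ht
    have hH' := hho _ ht'
    rw [heq] at hH
    have := hu _ _ h1 _ h1' hH hH'
    simp only at this h1 h1' h2 h2' h5 h5'
    subst this
    have hkk : k = k' := by
      funext i
      by_cases hi : i ∈ S
      · have e1 := hcrd _ ht i hi
        have e2 := hcrd _ ht' i hi
        rw [heq] at e1
        simp only at e1 e2
        obtain ⟨a1, a2, a3, a4⟩ := h2.2 i hi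
        obtain ⟨b1, b2, b3, b4⟩ := h2'.2 i hi
        have key : |((k i : ℤ) : ℝ) - (k' i : ℤ)| < 1 := by
          push_cast
          rw [abs_lt]
          by_cases hp : p S i
          · have := a3 hp; have := b3 hp
            constructor <;> linarith
          · have := a4 hp; have := b4 hp
            constructor <;> linarith
        have key2 : |(k i : ℤ) - k' i| < 1 := by exact_mod_cast key
        rw [Int.abs_lt_one_iff] at key2
        omega
      · have e1 : k i = 0 := by by_contra h; exact hi (h5 i h)
        have e2 : k' i = 0 := by by_contra h; exact hi (h5' i h)
        rw [e1, e2]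
    subst hkk
    have : b = b' := by simpa [F] using heq
    rw [this]
  constructor
  · rw [himg]; exact T.finite_toSet.image F
  · rw [himg, hinj.ncard_image, Set.ncard_coe_finset, Finset.card_sigma]
    refine Finset.sum_congr rfl fun b hb => ?_
    have hc := (mem_triang.1 (mem_boxes.1 hb).1).1.card_eq
    unfold monoCount
    split_ifs with h
    · rw [card_piAntidiag, hc]
      have : n + 1 + (m - ⌊b.2 0⌋₊) - 1 = n + (m - ⌊b.2 0⌋₊) := by omega
      rw [this, ← Nat.choose_symm_add]
    · rfl

end

section

lemma eq_of_sum_monoCount_eq {n N : ℕ} {a b : ℕ → ℤ}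
    (h : ∀ m, ∑ j ∈ Finset.range N, a j * monoCount n m j =
      ∑ j ∈ Finset.range N, b j * monoCount n m j) : ∀ j < N, a j = b j := by
  intro j
  induction j using Nat.strong_induction_on with
  | _ j ih =>
  intro hj
  have h1 := h j
  rw [← Finset.add_sum_erase _ _ (Finset.mem_range.2 hj),
    ← Finset.add_sum_erase (Finset.range N) (fun i => b i * _) (Finset.mem_range.2 hj)] at h1
  have h2 : ∑ i ∈ (Finset.range N).erase j, a i * (monoCount n j i : ℤ) =
      ∑ i ∈ (Finset.range N).erase j, b i * (monoCount n j i : ℤ) := by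
    refine Finset.sum_congr rfl fun i hi => ?_
    rw [Finset.mem_erase, Finset.mem_range] at hi
    rcases lt_or_gt_of_ne hi.1 with h | h
    · rw [ih i h hi.2]
    · simp [monoCount_of_lt h]
  rw [h2] at h1
  simpa [monoCount_self] using h1

variable {n : ℕ} {J : Type*} [Fintype J]

/-- The lattice points of height `m` in a set. -/
def slice (C : Set (Fin (n + 1) → ℝ)) (m : ℕ) : Set (Fin (n + 1) → ℝ) :=
  {x | x ∈ lat (n + 1) ∧ x ∈ C ∧ x 0 = m}

/-- The height functional. -/
def ht (n : ℕ) : (Fin (n + 1) → ℝ) →ₗ[ℝ] ℝ := LinearMap.proj 0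

/-- A cone over a full-dimensional lattice polytope whose vertices have height one, together with
its symmetric `h^*`-vector. -/
structure GorData (v : J → Fin (n + 1) → ℝ) (h : Polynomial ℤ) (d : ℕ) : Prop where
  lattice : ∀ i, v i ∈ lat (n + 1)
  height : ∀ i, v i 0 = 1
  span : Submodule.span ℝ (Set.range v) = ⊤
  count : ∀ m, ((slice (coneHull v) m).ncard : ℤ) =
    ∑ j ∈ Finset.range (n + 2), h.coeff j * monoCount n m j
  natDegree_eq : h.natDegree = d
  degree_le : d ≤ n
  symm : ∀ i ≤ d, h.coeff i = h.coeff (d - i)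

lemma height_nonneg {v : J → Fin (n + 1) → ℝ} (hv0 : ∀ i, v i 0 = 1) {x : Fin (n + 1) → ℝ}
    (hx : x ∈ coneHull v) : 0 ≤ x 0 :=
  coneHull_nonneg (f := ht n) (fun i => by simp [ht, hv0]) hx

lemma eq_zero_of_height {v : J → Fin (n + 1) → ℝ} (hv0 : ∀ i, v i 0 = 1) {x : Fin (n + 1) → ℝ}
    (hx : x ∈ coneHull v) (h0 : x 0 = 0) : x = 0 := by
  obtain ⟨c, hc, rfl⟩ := hx
  simp only [Finset.sum_apply, Pi.smul_apply, hv0, smul_eq_mul, mul_one] at h0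
  rw [Finset.sum_eq_zero_iff_of_nonneg fun i _ => hc i] at h0
  exact Finset.sum_eq_zero fun i hi => by rw [h0 i hi, zero_smul]

lemma slice_zero {v : J → Fin (n + 1) → ℝ} (hv0 : ∀ i, v i 0 = 1) :
    slice (coneHull v) 0 = {0} := by
  ext x
  constructor
  · rintro ⟨-, hx, h0⟩
    exact eq_zero_of_height hv0 hx (by simpa using h0)
  · rintro rfl
    exact ⟨(lat _).zero_mem, zero_mem_coneHull v, by simp⟩

lemma innerCone_subset {v : J → Fin (n + 1) → ℝ} {ξ x : Fin (n + 1) → ℝ} (hξ : ξ ∈ coneHull v)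
    (hx : x ∈ innerCone v ξ) : x ∈ coneHull v := by
  obtain ⟨ε, hε, hx⟩ := hx
  have : x = (x - ε • ξ) + ε • ξ := by simp
  rw [this]
  exact coneHull_add hx (coneHull_smul hε.le hξ)

lemma innerCone_add {v : J → Fin (n + 1) → ℝ} {ξ x y : Fin (n + 1) → ℝ}
    (hx : x ∈ innerCone v ξ) (hy : y ∈ coneHull v) : x + y ∈ innerCone v ξ := by
  obtain ⟨ε, hε, hx⟩ := hx
  refine ⟨ε, hε, ?_⟩
  rw [add_sub_right_comm]
  exact coneHull_add hx hy

/-- The two counting formulas given by a generic half-open triangulation: that for the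
interior of the cone is obtained by complementing the box points. -/
lemma exists_reciprocity {v : J → Fin (n + 1) → ℝ} (hv : ∀ i, v i ∈ lat (n + 1))
    (hv0 : ∀ i, v i 0 = 1) (hspan : Submodule.span ℝ (Set.range v) = ⊤) {ξ : Fin (n + 1) → ℝ}
    (hξ : GenericVec v ξ) (hξC : ξ ∈ coneHull v) :
    ∃ a : ℕ → ℤ, (∀ m, ((slice (coneHull v) m).ncard : ℤ) =
        ∑ j ∈ Finset.range (n + 2), a j * monoCount n m j) ∧
      ∀ m, (slice (innerCone v ξ) m).Finite ∧ ((slice (innerCone v ξ) m).ncard : ℤ) =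
        ∑ j ∈ Finset.range (n + 2), a j * monoCount n m (n + 1 - j) := by
  classical
  obtain ⟨ω, hω⟩ := exists_genericHeights v
  have he : ∀ i, 0 < ht n (v i) := fun i => by simp [ht, hv0]
  set p : Finset J → J → Prop := fun S i => crd v S i ξ < 0 with hp
  set p' : Finset J → J → Prop := fun S i => crd v S i (-ξ) < 0 with hp'
  have hc := slice_count hv hv0 (C := coneHull v) (p := p)
    (eventually_add_mem_iff he hspan hω hξ hξC)
    (fun x S hS S' hS' h h' => halfOpen_unique hξ hS hS' h h')
  have hc' := slice_count hv hv0 (C := innerCone v ξ) (p := p')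
    (mem_innerCone_iff he hspan hω hξ hξC)
    (fun x S hS S' hS' h h' => halfOpen_unique hξ.neg hS hS' h h')
  have hle : ∀ b ∈ boxes v ω p, ⌊b.2 0⌋₊ < n + 2 := by
    intro b hb
    obtain ⟨h1, h2⟩ := mem_boxes.1 hb
    have hb := (mem_triang.1 h1).1
    have h3 : (⌊b.2 0⌋₊ : ℝ) ≤ (n + 1 : ℕ) := by
      rw [← exists_nat_height hv0 hb h2.1 fun i hi => (h2.2 i hi).1, height_eq_sum_crd hv0 hb b.2]
      calc ∑ i ∈ b.1, crd v b.1 i b.2 ≤ ∑ i ∈ b.1, (1 : ℝ) :=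
            Finset.sum_le_sum fun i hi => (h2.2 i hi).2.1
        _ = _ := by rw [Finset.sum_const, hb.card_eq]; simp
    have : ⌊b.2 0⌋₊ ≤ n + 1 := by exact_mod_cast h3
    omega
  have hfib : ∀ f : ℕ → ℕ, ((∑ b ∈ boxes v ω p, f ⌊b.2 0⌋₊ : ℕ) : ℤ) =
      ∑ j ∈ Finset.range (n + 2),
        (((boxes v ω p).filter fun b => ⌊b.2 0⌋₊ = j).card : ℤ) * (f j : ℤ) := by
    intro f
    rw [← Finset.sum_fiberwise_of_maps_to (g := fun b => ⌊b.2 0⌋₊)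
      (fun b hb => Finset.mem_range.2 (hle b hb))]
    push_cast
    refine Finset.sum_congr rfl fun j _ => ?_
    rw [Finset.sum_congr rfl (g := fun _ => (f j : ℤ))
      (fun b hb => by rw [(Finset.mem_filter.1 hb).2])]
    simp
  have hpp : ∀ S ∈ triang v ω, ∀ i ∈ S, (p' S i ↔ ¬ p S i) := by
    intro S hS i hi
    simp only [hp, hp', map_neg, neg_lt_zero, not_lt]
    exact ⟨le_of_lt, fun h => h.lt_of_ne (hξ S (mem_triang.1 hS).1 i hi).symm⟩
  have hcompl : ∀ (q q' : Finset J → J → Prop),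
      (∀ S ∈ triang v ω, ∀ i ∈ S, (q' S i ↔ ¬ q S i)) → ∀ b ∈ boxes v ω q,
      (⟨b.1, ∑ i ∈ b.1, v i - b.2⟩ : Σ _ : Finset J, Fin (n + 1) → ℝ) ∈ boxes v ω q' := by
    intro q q' hq b hb
    obtain ⟨h1, h2⟩ := mem_boxes.1 hb
    refine mem_boxes.2 ⟨h1, (lat _).sub_mem ((lat _).sum_mem fun i _ => hv i) h2.1, ?_⟩
    intro i hi
    have hb := (mem_triang.1 h1).1
    have e1 : crd v b.1 i (∑ j ∈ b.1, v j) = 1 := crd_eq hb (c := fun _ => 1) (by simp) hi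
    obtain ⟨h3, h4, h5, h6⟩ := h2.2 i hi
    simp only [map_sub, e1, hq b.1 h1 i hi, not_not]
    exact ⟨by linarith, by linarith, fun h => by linarith [h6 h], fun h => by linarith [h5 h]⟩
  refine ⟨fun j => ((boxes v ω p).filter fun b => ⌊b.2 0⌋₊ = j).card, fun m => ?_, fun m => ?_⟩
  · rw [← hfib, slice, (hc m).2]
  · refine ⟨(hc' m).1, ?_⟩
    rw [← hfib fun j => monoCount n m (n + 1 - j), slice, (hc' m).2]
    congr 1
    refine Finset.sum_nbij' (fun b => ⟨b.1, ∑ i ∈ b.1, v i - b.2⟩)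
      (fun b => ⟨b.1, ∑ i ∈ b.1, v i - b.2⟩) (hcompl p' p fun S hS i hi => by
        rw [hpp S hS i hi, not_not]) (hcompl p p' hpp) ?_ ?_ ?_
    · rintro ⟨S, x⟩ _; simp
    · rintro ⟨S, x⟩ _; simp
    · rintro ⟨S, x⟩ hb
      obtain ⟨h1, h2⟩ := mem_boxes.1 hb
      have hx := exists_nat_height hv0 (mem_triang.1 h1).1 h2.1 fun i hi => (h2.2 i hi).1
      have hs : (∑ i ∈ S, v i - x) 0 = ((n + 1 : ℕ) : ℝ) - (⌊x 0⌋₊ : ℝ) := by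
        rw [← hx]
        simp only at h1
        simp [Finset.sum_apply, hv0, (mem_triang.1 h1).1.card_eq]
      have hb' := hcompl p' p (fun S hS i hi => by rw [hpp S hS i hi, not_not]) _ hb
      obtain ⟨h1', h2'⟩ := mem_boxes.1 hb'
      have hx' := exists_nat_height hv0 (mem_triang.1 h1').1 h2'.1 fun i hi => (h2'.2 i hi).1
      simp only at hx'
      rw [hs] at hx'
      simp only [hs]
      have h5 : ((n + 1 : ℕ) : ℝ) = ((⌊((n + 1 : ℕ) : ℝ) - (⌊x 0⌋₊ : ℝ)⌋₊ + ⌊x 0⌋₊ : ℕ) : ℝ) := by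
        push_cast at hx' ⊢
        linarith
      have h6 := Nat.cast_injective h5
      congr 1
      omega

/-- The Gorenstein point: the interior lattice points of a Gorenstein cone are the translates of
the lattice points of the cone by a single interior lattice point. -/
lemma GorData.exists_point {v : J → Fin (n + 1) → ℝ} {h : Polynomial ℤ} {d : ℕ}
    (H : GorData v h d) {ξ : Fin (n + 1) → ℝ} (hξ : GenericVec v ξ) (hξC : ξ ∈ coneHull v) :
    ∃ w ∈ lat (n + 1), w ∈ innerCone v ξ ∧ w 0 = (n + 1 - d : ℕ) ∧
      ∀ x ∈ lat (n + 1), x ∈ innerCone v ξ → x - w ∈ coneHull v := by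
  obtain ⟨a, ha, hb⟩ := exists_reciprocity H.lattice H.height H.span hξ hξC
  have hah : ∀ j < n + 2, a j = h.coeff j :=
    eq_of_sum_monoCount_eq fun m => by rw [← ha, H.count]
  have hdn := H.degree_le
  have h0 : h.coeff 0 = 1 := by
    have := H.count 0
    rw [slice_zero H.height, Set.ncard_singleton, Finset.sum_eq_single 0] at this
    · simpa [monoCount_self] using this.symm
    · intro j _ hj
      simp [monoCount_of_lt (Nat.pos_of_ne_zero hj)]
    · simp
  set r := n + 1 - d with hr
  have hcoeff : ∀ j, d < j → h.coeff j = 0 := fun j hj =>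
    Polynomial.coeff_eq_zero_of_natDegree_lt (H.natDegree_eq ▸ hj)
  have hL : ∀ m, ((slice (innerCone v ξ) m).ncard : ℤ) =
      ∑ j ∈ Finset.range (d + 1), h.coeff j * monoCount n m (j + r) := by
    intro m
    rw [(hb m).2]
    have e1 : ∑ j ∈ Finset.range (n + 2), a j * (monoCount n m (n + 1 - j) : ℤ) =
        ∑ j ∈ Finset.range (d + 1), h.coeff j * monoCount n m (n + 1 - j) := by
      rw [Finset.sum_congr rfl (g := fun j => h.coeff j * (monoCount n m (n + 1 - j) : ℤ))
        fun j hj => by rw [hah j (Finset.mem_range.1 hj)]]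
      symm
      refine Finset.sum_subset (Finset.range_subset_range.2 (by omega)) fun j _ hj => ?_
      rw [Finset.mem_range, not_lt] at hj
      rw [hcoeff j hj, zero_mul]
    rw [e1, ← Finset.sum_range_reflect]
    refine Finset.sum_congr rfl fun j hj => ?_
    rw [Finset.mem_range] at hj
    rw [H.symm j (by omega)]
    congr 3; omega
  have hsmall : ∀ m < r, slice (innerCone v ξ) m = ∅ := by
    intro m hm
    rw [← Set.ncard_eq_zero (hb m).1]
    have := hL m
    rw [Finset.sum_eq_zero] at this
    · exact_mod_cast this
    · intro j _
      rw [monoCount_of_lt (by omega)]; simp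
  have hshift : ∀ m, (slice (innerCone v ξ) (m + r)).ncard = (slice (coneHull v) m).ncard := by
    intro m
    have h1 := hL (m + r)
    have h2 := H.count m
    have e1 : ∑ j ∈ Finset.range (n + 2), h.coeff j * (monoCount n m j : ℤ) =
        ∑ j ∈ Finset.range (d + 1), h.coeff j * monoCount n m j := by
      symm
      refine Finset.sum_subset (Finset.range_subset_range.2 (by omega)) fun j _ hj => ?_
      rw [Finset.mem_range, not_lt] at hj
      rw [hcoeff j hj, zero_mul]
    simp only [monoCount_add] at h1
    rw [← e1, ← h2] at h1
    exact_mod_cast h1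
  have hone : (slice (innerCone v ξ) r).ncard = 1 := by
    have := hshift 0
    rwa [slice_zero H.height, Set.ncard_singleton, zero_add] at this
  obtain ⟨w, hw⟩ := Set.ncard_eq_one.1 hone
  have hwm : w ∈ slice (innerCone v ξ) r := by rw [hw]; rfl
  refine ⟨w, hwm.1, hwm.2.1, hwm.2.2, fun x hx hxi => ?_⟩
  obtain ⟨m, hm⟩ : ∃ m : ℕ, x 0 = m := by
    have h1 := height_nonneg H.height (innerCone_subset hξC hxi)
    obtain ⟨z, hz⟩ := hx 0
    rw [hz] at h1 ⊢
    lift z to ℕ using (by exact_mod_cast h1)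
    exact ⟨z, by simp⟩
  have hxs : x ∈ slice (innerCone v ξ) m := ⟨hx, hxi, hm⟩
  rcases lt_or_ge m r with hlt | hge
  · rw [hsmall m hlt] at hxs
    exact absurd hxs (Set.notMem_empty x)
  obtain ⟨k, rfl⟩ := Nat.exists_eq_add_of_le' hge
  have hsub : (fun y => y + w) '' slice (coneHull v) k ⊆ slice (innerCone v ξ) (k + r) := by
    rintro _ ⟨y, hy, rfl⟩
    refine ⟨(lat _).add_mem hy.1 hwm.1, by
      simpa only [add_comm y w] using innerCone_add hwm.2.1 hy.2.1, ?_⟩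
    change (y + w) 0 = _
    rw [Pi.add_apply, hy.2.2, hwm.2.2]; push_cast; ring
  have heq := Set.eq_of_subset_of_ncard_le hsub (by
    rw [(add_left_injective w).injOn.ncard_image, hshift]) (hb _).1
  rw [← heq] at hxs
  obtain ⟨y, hy, rfl⟩ := hxs
  simpa using hy.2.1

end

section

/-- The functional `x ↦ g ⬝ᵥ x`. -/
def dotL {N : ℕ} (g : Fin N → ℝ) : (Fin N → ℝ) →ₗ[ℝ] ℝ := dotProductEquiv ℝ (Fin N) g

@[simp] lemma dotL_apply {N : ℕ} (g x : Fin N → ℝ) : dotL g x = g ⬝ᵥ x := rfl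

lemma exists_dotL_eq {N : ℕ} (f : (Fin N → ℝ) →ₗ[ℝ] ℝ) : ∃ g, dotL g = f :=
  (dotProductEquiv ℝ (Fin N)).surjective f

lemma convex_coneHull {E J : Type*} [AddCommGroup E] [Module ℝ E] [Fintype J] (v : J → E) :
    Convex ℝ (coneHull v) := fun _ hx _ hy _ _ ha hb _ =>
  coneHull_add (coneHull_smul ha hx) (coneHull_smul hb hy)

variable {n : ℕ} {J : Type*} [Fintype J]

/-- The cone over a lattice polytope together with its Gorenstein point `w`. -/
structure GorPoint (v : J → Fin (n + 1) → ℝ) (ξ w : Fin (n + 1) → ℝ) (r : ℕ) : Prop where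
  lattice : ∀ i, v i ∈ lat (n + 1)
  height : ∀ i, v i 0 = 1
  span : Submodule.span ℝ (Set.range v) = ⊤
  inner : IsInner v ξ
  mem : ξ ∈ coneHull v
  point_lattice : w ∈ lat (n + 1)
  point_inner : w ∈ innerCone v ξ
  point_height : w 0 = r
  pos : 0 < r
  sub_mem : ∀ x ∈ lat (n + 1), x ∈ innerCone v ξ → x - w ∈ coneHull v

/-- The normalized dual slice. -/
def dualSlice (v : J → Fin (n + 1) → ℝ) (w : Fin (n + 1) → ℝ) : Set (Fin (n + 1) → ℝ) :=
  {u | (∀ i, 0 ≤ u ⬝ᵥ v i) ∧ u ⬝ᵥ w = 1}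

namespace GorPoint

variable {v : J → Fin (n + 1) → ℝ} {ξ w : Fin (n + 1) → ℝ} {r : ℕ}

lemma isInner_point (H : GorPoint v ξ w r) : IsInner v w := by
  intro x
  obtain ⟨ε, hε, h1⟩ := H.point_inner
  obtain ⟨δ, hδ, h2⟩ := H.inner x
  refine ⟨ε * δ, mul_pos hε hδ, ?_⟩
  have : w + (ε * δ) • x = (w - ε • ξ) + ε • (ξ + δ • x) := by module
  rw [this]
  exact coneHull_add h1 (coneHull_smul hε.le h2)

lemma convex_dualSlice : Convex ℝ (dualSlice v w) := by
  intro x hx y hy a b ha hb hab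
  refine ⟨fun i => ?_, ?_⟩
  · have := hx.1 i
    have := hy.1 i
    rw [add_dotProduct, smul_dotProduct, smul_dotProduct, smul_eq_mul, smul_eq_mul]
    positivity
  · rw [add_dotProduct, smul_dotProduct, smul_dotProduct, hx.2, hy.2]
    simpa using hab

lemma isCompact_dualSlice (H : GorPoint v ξ w r) : IsCompact (dualSlice v w) := by
  have hc : ∀ y : Fin (n + 1) → ℝ, Continuous fun u : Fin (n + 1) → ℝ => u ⬝ᵥ y := fun y => by
    simp only [dotProduct]; fun_prop
  have hclosed : IsClosed (dualSlice v w) := by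
    have : dualSlice v w = (⋂ i, {u | 0 ≤ u ⬝ᵥ v i}) ∩ {u | u ⬝ᵥ w = 1} := by
      ext u; simp [dualSlice]
    rw [this]
    exact (isClosed_iInter fun i => isClosed_le continuous_const (hc _)).inter
      (isClosed_eq (hc _) continuous_const)
  choose δ hδ hmem using fun k : Fin (n + 1) => H.isInner_point (Pi.single k 1)
  choose δ' hδ' hmem' using fun k : Fin (n + 1) => H.isInner_point (-Pi.single k 1)
  refine (isCompact_univ_pi fun k => isCompact_Icc (a := -(1 / δ k))
    (b := 1 / δ' k)).of_isClosed_subset hclosed fun u hu k _ => ?_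
  have h1 := coneHull_nonneg (f := dotL u) hu.1 (hmem k)
  have h2 := coneHull_nonneg (f := dotL u) hu.1 (hmem' k)
  simp only [map_add, map_smul, map_neg, dotL_apply, hu.2, dotProduct_single, smul_eq_mul,
    mul_one] at h1 h2
  constructor
  · rw [neg_le, le_div_iff₀ (hδ k)]; linarith
  · rw [le_div_iff₀ (hδ' k)]; linarith

lemma eq_of_mem_extremePoints {u l : Fin (n + 1) → ℝ}
    (hu : u ∈ (dualSlice v w).extremePoints ℝ) (hl : l ∈ dualSlice v w)
    (h : ∀ i, u ⬝ᵥ v i = 0 → l ⬝ᵥ v i = 0) : l = u := by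
  rw [mem_extremePoints] at hu
  have hev : ∀ᶠ ε in 𝓝[>] (0 : ℝ), ∀ i, 0 ≤ ((1 + ε) • u - ε • l) ⬝ᵥ v i := by
    rw [eventually_all]
    intro i
    simp only [sub_dotProduct, smul_dotProduct, smul_eq_mul]
    rcases (hu.1.1 i).eq_or_lt with h0 | h0
    · rw [h i h0.symm, ← h0]; simp
    · have : Tendsto (fun ε : ℝ => (1 + ε) * (u ⬝ᵥ v i) - ε * (l ⬝ᵥ v i)) (𝓝 0)
          (𝓝 ((1 + 0) * (u ⬝ᵥ v i) - 0 * (l ⬝ᵥ v i))) := Continuous.tendsto (by fun_prop) 0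
      simp only [add_zero, one_mul, zero_mul, sub_zero] at this
      filter_upwards [(this.mono_left nhdsWithin_le_nhds).eventually_const_lt h0] with ε hε
      exact hε.le
  obtain ⟨ε, h1, hε⟩ := (hev.and self_mem_nhdsWithin).exists
  have hε : 0 < ε := hε
  refine (hu.2 l hl ((1 + ε) • u - ε • l) ⟨h1, ?_⟩ ?_).1
  · rw [sub_dotProduct, smul_dotProduct, smul_dotProduct, hu.1.2, hl.2]; simp
  · refine ⟨ε / (1 + ε), 1 / (1 + ε), by positivity, by positivity, by field_simp; ring, ?_⟩
    have : (1 + ε) ≠ 0 := by positivity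
    ext k
    simp only [Pi.add_apply, Pi.smul_apply, Pi.sub_apply, smul_eq_mul]
    field_simp
    ring

lemma finite_extremePoints : ((dualSlice v w).extremePoints ℝ).Finite := by
  refine Set.Finite.of_injOn (f := fun u => {i : J | u ⬝ᵥ v i = 0}) (t := Set.univ)
    (fun _ _ => Set.mem_univ _) ?_ Set.finite_univ
  intro u hu l hl h
  refine (eq_of_mem_extremePoints hu hl.1 fun i hi => ?_).symm
  have : i ∈ {i : J | u ⬝ᵥ v i = 0} := hi
  simp only at h
  rwa [h] at this

/-- The facet functionals of the cone. -/
def facets (v : J → Fin (n + 1) → ℝ) (w : Fin (n + 1) → ℝ) : Finset (Fin (n + 1) → ℝ) :=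
  (finite_extremePoints (v := v) (w := w)).toFinset

lemma mem_facets {u : Fin (n + 1) → ℝ} :
    u ∈ facets v w ↔ u ∈ (dualSlice v w).extremePoints ℝ := by
  simp [facets]

lemma facets_nonneg {u : Fin (n + 1) → ℝ} (hu : u ∈ facets v w) (i : J) : 0 ≤ u ⬝ᵥ v i :=
  (mem_facets.1 hu).1.1 i

lemma facets_point {u : Fin (n + 1) → ℝ} (hu : u ∈ facets v w) : u ⬝ᵥ w = 1 :=
  (mem_facets.1 hu).1.2

lemma convexHull_facets (H : GorPoint v ξ w r) :
    convexHull ℝ (facets v w : Set (Fin (n + 1) → ℝ)) = dualSlice v w := by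
  have h1 := closure_convexHull_extremePoints H.isCompact_dualSlice convex_dualSlice
  have h2 : (facets v w : Set (Fin (n + 1) → ℝ)) = (dualSlice v w).extremePoints ℝ := by
    ext u; simp [facets]
  rw [(finite_extremePoints.isClosed_convexHull ℝ).closure_eq] at h1
  rw [h2, h1]

lemma pos_of_mem_dualSlice (H : GorPoint v ξ w r) {x : Fin (n + 1) → ℝ}
    (hx : ∀ u ∈ facets v w, 0 < u ⬝ᵥ x) {l : Fin (n + 1) → ℝ} (hl : l ∈ dualSlice v w) :
    0 < l ⬝ᵥ x := by
  rw [← H.convexHull_facets] at hl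
  have : convexHull ℝ (facets v w : Set (Fin (n + 1) → ℝ)) ⊆ {l | 0 < l ⬝ᵥ x} := by
    refine convexHull_min hx ?_
    have := (convex_Ioi (0 : ℝ)).linear_preimage (dotL x)
    simpa [Set.preimage, dotProduct_comm] using this
  exact this hl

lemma height_dualSlice (H : GorPoint v ξ w r) :
    (r : ℝ)⁻¹ • (Pi.single 0 1 : Fin (n + 1) → ℝ) ∈ dualSlice v w := by
  have hr : (0 : ℝ) < r := by exact_mod_cast H.pos
  refine ⟨fun i => ?_, ?_⟩
  · simp [H.height]
  · simp [H.point_height, hr.ne']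

lemma mem_coneHull_of_facets_pos (H : GorPoint v ξ w r) {y : Fin (n + 1) → ℝ}
    (hy : ∀ u ∈ facets v w, 0 < u ⬝ᵥ y) : y ∈ coneHull v := by
  have hr : (0 : ℝ) < r := by exact_mod_cast H.pos
  have hy0 : 0 < y 0 := by
    have := H.pos_of_mem_dualSlice hy H.height_dualSlice
    simp only [smul_dotProduct, single_dotProduct, one_mul, smul_eq_mul] at this
    exact pos_of_mul_pos_right this (by positivity)
  by_contra hn
  have hnK : (y 0)⁻¹ • y ∉ convexHull ℝ (Set.range v) := by
    intro h
    have hsub : convexHull ℝ (Set.range v) ⊆ coneHull v :=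
      convexHull_min (Set.range_subset_iff.2 (mem_coneHull v)) (convex_coneHull v)
    apply hn
    have := coneHull_smul hy0.le (hsub h)
    rwa [smul_smul, mul_inv_cancel₀ hy0.ne', one_smul] at this
  obtain ⟨f, c, h1, h2⟩ := geometric_hahn_banach_closed_point (convex_convexHull ℝ _)
    ((Set.finite_range v).isClosed_convexHull ℝ) hnK
  obtain ⟨g, hg⟩ := exists_dotL_eq (c • ht n - (f : (Fin (n + 1) → ℝ) →ₗ[ℝ] ℝ))
  have hgx : ∀ x, g ⬝ᵥ x = c * x 0 - f x := fun x => by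
    rw [← dotL_apply, hg]; simp [ht]
  have hgv : ∀ i, 0 < g ⬝ᵥ v i := fun i => by
    have := h1 (v i) (subset_convexHull ℝ _ ⟨i, rfl⟩)
    rw [hgx, H.height]; linarith
  have hgy : g ⬝ᵥ y < 0 := by
    have h3 : c < (y 0)⁻¹ * f y := by simpa using h2
    rw [hgx, sub_neg]
    rwa [inv_mul_eq_div, lt_div_iff₀ hy0] at h3
  have hgw : 0 < g ⬝ᵥ w := by
    obtain ⟨a, ha, haw⟩ := innerCone_subset H.mem H.point_inner
    have hw0 : w 0 = ∑ i, a i := by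
      rw [← haw]; simp [Finset.sum_apply, H.height]
    have hsum : 0 < ∑ i, a i := by rw [← hw0, H.point_height]; exact hr
    obtain ⟨i, hi, hpos⟩ := Finset.exists_lt_of_sum_lt (s := Finset.univ)
      (f := fun _ : J => (0 : ℝ)) (g := a) (by simpa using hsum)
    rw [← haw, dotProduct_sum]
    refine Finset.sum_pos' (fun i _ => ?_) ⟨i, hi, ?_⟩
    · rw [dotProduct_smul]; exact mul_nonneg (ha i) (hgv i).le
    · rw [dotProduct_smul]; exact mul_pos hpos (hgv i)
  have hmem : (g ⬝ᵥ w)⁻¹ • g ∈ dualSlice v w := by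
    refine ⟨fun i => ?_, ?_⟩
    · rw [smul_dotProduct]; exact mul_nonneg (by positivity) (hgv i).le
    · rw [smul_dotProduct, smul_eq_mul, inv_mul_cancel₀ hgw.ne']
  have := H.pos_of_mem_dualSlice hy hmem
  rw [smul_dotProduct, smul_eq_mul] at this
  have h4 : 0 < g ⬝ᵥ y := pos_of_mul_pos_right this (by positivity)
  linarith

lemma mem_innerCone_of_facets_pos (H : GorPoint v ξ w r) {x : Fin (n + 1) → ℝ}
    (hx : ∀ u ∈ facets v w, 0 < u ⬝ᵥ x) : x ∈ innerCone v ξ := by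
  have : ∀ᶠ ε in 𝓝[>] (0 : ℝ), ∀ u : facets v w, 0 < u.1 ⬝ᵥ (x - ε • ξ) := by
    rw [eventually_all]
    intro u
    have h1 : Tendsto (fun ε : ℝ => u.1 ⬝ᵥ x - ε * (u.1 ⬝ᵥ ξ)) (𝓝 0)
        (𝓝 (u.1 ⬝ᵥ x - 0 * (u.1 ⬝ᵥ ξ))) := Continuous.tendsto (by fun_prop) 0
    simp only [zero_mul, sub_zero] at h1
    filter_upwards [(h1.mono_left nhdsWithin_le_nhds).eventually_const_lt (hx u u.2)] with ε hε
    simpa [dotProduct_sub, dotProduct_smul] using hε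
  obtain ⟨ε, h1, h2⟩ := (this.and self_mem_nhdsWithin).exists
  exact ⟨ε, h2, H.mem_coneHull_of_facets_pos fun u hu => h1 ⟨u, hu⟩⟩

lemma one_le_facet (H : GorPoint v ξ w r) {u x : Fin (n + 1) → ℝ} (hu : u ∈ facets v w)
    (hx : x ∈ lat (n + 1)) (hpos : 0 < u ⬝ᵥ x) : 1 ≤ u ⬝ᵥ x := by
  classical
  set s := ∑ i with u ⬝ᵥ v i = 0, v i with hs
  have hus : u ⬝ᵥ s = 0 := by
    rw [hs, dotProduct_sum]
    exact Finset.sum_eq_zero fun i hi => (Finset.mem_filter.1 hi).2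
  have hsl : s ∈ lat (n + 1) := (lat _).sum_mem fun i _ => H.lattice i
  have hsnn : ∀ l ∈ facets v w, 0 ≤ l ⬝ᵥ s := by
    intro l hl
    rw [hs, dotProduct_sum]
    exact Finset.sum_nonneg fun i _ => facets_nonneg hl i
  have hev : ∀ᶠ M : ℕ in atTop, ∀ l : facets v w, 0 < l.1 ⬝ᵥ (x + (M : ℝ) • s) := by
    rw [eventually_all]
    rintro ⟨l, hl⟩
    simp only [dotProduct_add, dotProduct_smul, smul_eq_mul]
    rcases (hsnn l hl).eq_or_lt with h0 | h0
    · have : l = u := by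
        refine eq_of_mem_extremePoints (mem_facets.1 hu) (mem_facets.1 hl).1 fun i hi => ?_
        rw [hs, dotProduct_sum] at h0
        exact (Finset.sum_eq_zero_iff_of_nonneg fun i _ => facets_nonneg hl i).1 h0.symm i
          (by simpa using hi)
      subst this
      simp [hus, hpos]
    · have : Tendsto (fun M : ℕ => l ⬝ᵥ x + (M : ℝ) * (l ⬝ᵥ s)) atTop atTop :=
        tendsto_atTop_add_const_left _ _
          ((tendsto_natCast_atTop_atTop (R := ℝ)).atTop_mul_const h0)
      exact this.eventually_gt_atTop 0
  obtain ⟨M, hM⟩ := hev.exists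
  have hin := H.mem_innerCone_of_facets_pos fun l hl => hM ⟨l, hl⟩
  have hc := H.sub_mem _ ((lat _).add_mem hx (natSmul_mem_lat hsl M)) hin
  have := coneHull_nonneg (f := dotL u) (facets_nonneg hu) hc
  simp only [map_sub, map_add, map_smul, dotL_apply, hus, facets_point hu, smul_eq_mul] at this
  linarith

lemma facet_mem_lat (H : GorPoint v ξ w r) {u : Fin (n + 1) → ℝ} (hu : u ∈ facets v w) :
    u ∈ lat (n + 1) := by
  intro k
  have hx : (Pi.single k 1 : Fin (n + 1) → ℝ) ∈ lat (n + 1) := fun i => by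
    by_cases h : i = k
    · subst h; exact ⟨1, by simp⟩
    · exact ⟨0, by simp [h]⟩
  refine ⟨⌊u k⌋, ?_⟩
  have h1 : u ⬝ᵥ (Pi.single k 1 - (⌊u k⌋ : ℝ) • w) = Int.fract (u k) := by
    rw [dotProduct_sub, dotProduct_smul, facets_point hu]
    simp
  rcases (Int.fract_nonneg (u k)).eq_or_lt with h0 | h0
  · rw [Int.fract] at h0; linarith
  · have := H.one_le_facet hu ((lat _).sub_mem hx (intSmul_mem_lat H.point_lattice _))
      (by rw [h1]; exact h0)
    rw [h1] at this
    exact absurd (Int.fract_lt_one (u k)) (not_lt.2 this)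

lemma height_mem_coneHull_facets (H : GorPoint v ξ w r) :
    (Pi.single 0 1 : Fin (n + 1) → ℝ) ∈ coneHull (fun u : facets v w => u.1) := by
  have hr : (0 : ℝ) < r := by exact_mod_cast H.pos
  have h1 := H.height_dualSlice
  rw [← H.convexHull_facets] at h1
  have h2 : convexHull ℝ (facets v w : Set (Fin (n + 1) → ℝ)) ⊆
      coneHull (fun u : facets v w => u.1) :=
    convexHull_min (fun u hu => mem_coneHull (fun u : facets v w => u.1) ⟨u, hu⟩)
      (convex_coneHull _)
  have := coneHull_smul hr.le (h2 h1)
  rwa [smul_smul, mul_inv_cancel₀ hr.ne', one_smul] at this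

lemma eq_zero_of_facets (H : GorPoint v ξ w r) {x : Fin (n + 1) → ℝ}
    (hx : ∀ u ∈ facets v w, u ⬝ᵥ x = 0) : x = 0 := by
  have hmem : ∀ t : ℝ, w + t • x ∈ coneHull v := fun t => by
    refine H.mem_coneHull_of_facets_pos fun u hu => ?_
    rw [dotProduct_add, dotProduct_smul, facets_point hu, hx u hu]; simp
  have hx0 : x 0 = 0 := by
    have h1 := height_nonneg H.height (hmem ((x 0)⁻¹ * (-(w 0) - 1)))
    by_contra h
    simp only [Pi.add_apply, Pi.smul_apply, smul_eq_mul] at h1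
    rw [mul_right_comm, inv_mul_cancel₀ h] at h1
    linarith
  ext k
  by_contra hk
  have hk : x k ≠ 0 := hk
  obtain ⟨B, hB⟩ : ∃ B : ℝ, ∀ t : ℝ, |w k + t * x k| ≤ B := by
    refine ⟨r * ∑ i, |v i k|, fun t => ?_⟩
    obtain ⟨c, hc, hcx⟩ := hmem t
    have h0 := congrFun hcx 0
    have h1 := congrFun hcx k
    simp only [Finset.sum_apply, Pi.smul_apply, smul_eq_mul, H.height, mul_one, Pi.add_apply,
      hx0, mul_zero, add_zero, H.point_height] at h0 h1
    rw [← h1, ← h0, Finset.mul_sum]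
    refine (Finset.abs_sum_le_sum_abs _ _).trans (Finset.sum_le_sum fun i _ => ?_)
    rw [abs_mul, abs_of_nonneg (hc i)]
    exact mul_le_mul_of_nonneg_right
      (Finset.single_le_sum (f := c) (fun i _ => hc i) (Finset.mem_univ i)) (abs_nonneg _)
  have := hB ((x k)⁻¹ * (B + 1 - w k))
  rw [mul_right_comm, inv_mul_cancel₀ hk, one_mul] at this
  have := le_abs_self (w k + (B + 1 - w k))
  linarith

lemma span_facets (H : GorPoint v ξ w r) :
    Submodule.span ℝ (Set.range fun u : facets v w => u.1) = ⊤ := by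
  by_contra hne
  obtain ⟨f, hf, hle⟩ := Submodule.exists_le_ker_of_lt_top _ (lt_top_iff_ne_top.2 hne)
  obtain ⟨x, rfl⟩ := exists_dotL_eq f
  refine hf ?_
  have : x = 0 := H.eq_zero_of_facets fun u hu => by
    have := hle (Submodule.subset_span ⟨⟨u, hu⟩, rfl⟩)
    rw [dotProduct_comm]
    simpa using this
  simp [this, dotL]

end GorPoint

end

section

variable {n : ℕ} {J : Type*} [Fintype J]

lemma exists_dotProduct_ne_zero {v : J → Fin (n + 1) → ℝ}
    (hspan : Submodule.span ℝ (Set.range v) = ⊤) {g : Fin (n + 1) → ℝ} (hg : g ≠ 0) :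
    ∃ i, g ⬝ᵥ v i ≠ 0 := by
  by_contra! h
  apply hg
  have : dotL g = 0 := by
    refine LinearMap.ext_on_range hspan fun i => ?_
    simpa using h i
  simpa [dotL] using this

lemma one_le_of_int {x : ℝ} (hx : ∃ z : ℤ, x = z) (h : 0 < x) : 1 ≤ x := by
  obtain ⟨z, rfl⟩ := hx
  exact_mod_cast h

/-- A Cayley decomposition of the height functional into nonzero integral functionals which are
nonnegative on the cone. -/
structure CayleyDecomp (v : J → Fin (n + 1) → ℝ) (w : Fin (n + 1) → ℝ)
    (T : Finset (Fin (n + 1) → ℝ)) : Prop where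
  lattice : ∀ u ∈ T, u ∈ lat (n + 1)
  nonneg : ∀ u ∈ T, ∀ i, 0 ≤ u ⬝ᵥ v i
  sum_eq : ∑ u ∈ T, u = Pi.single 0 1
  point : ∀ u ∈ T, 1 ≤ u ⬝ᵥ w
  ne_zero : ∀ u ∈ T, u ≠ 0

namespace GorPoint

variable {v : J → Fin (n + 1) → ℝ} {ξ w : Fin (n + 1) → ℝ} {r : ℕ}

lemma exists_one_le_facet (H : GorPoint v ξ w r) {u : Fin (n + 1) → ℝ} (hu : u ∈ facets v w) :
    ∃ i, 1 ≤ u ⬝ᵥ v i := by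
  have hne : u ≠ 0 := by
    rintro rfl
    simpa using facets_point hu
  obtain ⟨i, hi⟩ := exists_dotProduct_ne_zero H.span hne
  exact ⟨i, H.one_le_facet hu (H.lattice i) ((facets_nonneg hu i).lt_of_ne hi.symm)⟩

lemma exists_cayleyDecomp (H : GorPoint v ξ w r) {d : ℕ} (hd : 0 < d) (hrd : r + d = n + 1) :
    ∃ T, CayleyDecomp v w T ∧ n + 1 ≤ T.card + (2 * d - 1) := by
  classical
  have hr : (0 : ℝ) < r := by exact_mod_cast H.pos
  set e : Fin (n + 1) → ℝ := Pi.single 0 1 with he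
  have hev : ∀ i, e ⬝ᵥ v i = 1 := fun i => by simp [he, H.height]
  have hew : e ⬝ᵥ w = r := by simp [he, H.point_height]
  have hel : e ∈ lat (n + 1) := fun i => by
    by_cases h : i = 0
    · subst h; exact ⟨1, by simp [he]⟩
    · exact ⟨0, by simp [he, h]⟩
  let f : facets v w → Fin (n + 1) → ℝ := fun u => u.1
  have hfw : ∀ u, dotL w (f u) = 1 := fun u => by
    rw [dotL_apply, dotProduct_comm]; exact facets_point u.2
  obtain ⟨c0, hc0, hce⟩ := H.height_mem_coneHull_facets
  obtain ⟨j, hj⟩ : ∃ j, 0 < c0 j := by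
    by_contra! h
    have : ∑ u : facets v w, c0 u • u.1 = 0 := Finset.sum_eq_zero fun u _ => by
      rw [le_antisymm (h u) (hc0 u), zero_smul]
    rw [hce] at this
    have := hew.symm.trans (by rw [he, this, zero_dotProduct])
    linarith
  obtain ⟨c, hc, hcs, -, hli⟩ := exists_linearIndepOn_support (v := f) (e := dotL w)
    (fun u => by rw [hfw]; exact one_pos) c0 hc0 j hj
  have hcs : ∑ u, c u • f u = e := hcs.trans hce
  have hfnn : ∀ u i, 0 ≤ f u ⬝ᵥ v i := fun u i => facets_nonneg u.2 i
  have hc1 : ∀ u, c u ≤ 1 := by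
    intro u
    obtain ⟨i, hi⟩ := H.exists_one_le_facet u.2
    have h1 := hev i
    rw [← hcs, sum_dotProduct] at h1
    have h2 := Finset.single_le_sum (f := fun u => (c u • f u) ⬝ᵥ v i) (fun l _ => by
      rw [smul_dotProduct]; exact mul_nonneg (hc l) (hfnn l i)) (Finset.mem_univ u)
    rw [h1, smul_dotProduct, smul_eq_mul] at h2
    exact (le_mul_of_one_le_right (hc u) hi).trans h2
  set J1 : Finset (facets v w) := Finset.univ.filter fun u => c u = 1 with hJ1
  set y : Fin (n + 1) → ℝ := ∑ u with ¬ c u = 1, c u • f u with hy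
  have hsplit : ∑ u ∈ J1, f u + y = e := by
    rw [← hcs, ← Finset.sum_filter_add_sum_filter_not Finset.univ (fun u => c u = 1)]
    congr 1
    exact Finset.sum_congr rfl fun u hu => by rw [(Finset.mem_filter.1 hu).2, one_smul]
  have hyl : y ∈ lat (n + 1) := by
    rw [eq_sub_iff_add_eq'.2 hsplit]
    exact (lat _).sub_mem hel ((lat _).sum_mem fun u _ => H.facet_mem_lat u.2)
  have hynn : ∀ i, 0 ≤ y ⬝ᵥ v i := fun i => by
    rw [hy, sum_dotProduct]
    exact Finset.sum_nonneg fun u _ => by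
      rw [smul_dotProduct]; exact mul_nonneg (hc u) (hfnn u i)
  have hyw : y ⬝ᵥ w = ∑ u with ¬ c u = 1, c u := by
    rw [hy, sum_dotProduct]
    refine Finset.sum_congr rfl fun u _ => ?_
    have := hfw u
    rw [dotL_apply, dotProduct_comm] at this
    rw [smul_dotProduct, this]; simp
  have hJw : (J1.card : ℝ) + y ⬝ᵥ w = r := by
    rw [← hew, ← hsplit, add_dotProduct]
    congr 1
    rw [sum_dotProduct, Finset.sum_congr rfl (g := fun _ => (1 : ℝ)) fun u _ => facets_point u.2]
    simp
  -- the bound on the weight of the fractional part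
  have hyd : y ⬝ᵥ w ≤ d := by
    obtain ⟨S, hS, hb⟩ := exists_isBas_superset (v := f) H.span_facets hli
    have hcard : S.card = n + 1 := by
      have h1 := Module.finrank_eq_card_basis hb.basis
      simpa using h1.symm
    set Y := ∑ u ∈ S, f u - y with hY
    have hYl : Y ∈ lat (n + 1) :=
      (lat _).sub_mem ((lat _).sum_mem fun u _ => H.facet_mem_lat u.2) hyl
    have hys : y = ∑ u ∈ S, (if c u = 1 then 0 else c u) • f u := by
      rw [hy, Finset.sum_filter, ← Finset.sum_subset (Finset.subset_univ S)]
      · refine Finset.sum_congr rfl fun u _ => ?_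
        split_ifs <;> simp
      · intro u _ hu
        have : c u = 0 := by
          by_contra h
          exact hu (hS h)
        simp [this]
    have hYs : Y = ∑ u ∈ S, (1 - if c u = 1 then 0 else c u) • f u := by
      rw [hY, hys]
      simp [sub_smul, Finset.sum_sub_distrib]
    have hcoef : ∀ u, 0 < 1 - (if c u = 1 then 0 else c u) := by
      intro u
      split_ifs with h
      · simp
      · have := (hc1 u).lt_of_ne h
        linarith
    have hYv : ∀ i, 1 ≤ Y ⬝ᵥ v i := by
      intro i
      refine one_le_of_int (exists_int_dotProduct hYl (H.lattice i)) ?_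
      obtain ⟨u, hu, hne⟩ : ∃ u ∈ S, f u ⬝ᵥ v i ≠ 0 := by
        by_contra! h
        have h0 : dotL (v i) = 0 := by
          refine LinearMap.ext_on hb.2 ?_
          rintro _ ⟨u, hu, rfl⟩
          simpa [dotProduct_comm] using h u hu
        have h2 := congrArg (fun l => l e) h0
        simp only [dotL_apply, LinearMap.zero_apply] at h2
        rw [dotProduct_comm, hev] at h2
        exact one_ne_zero h2
      rw [hYs, sum_dotProduct]
      refine Finset.sum_pos' (fun l _ => ?_) ⟨u, hu, ?_⟩
      · rw [smul_dotProduct]; exact mul_nonneg (hcoef l).le (hfnn l i)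
      · rw [smul_dotProduct]
        exact mul_pos (hcoef u) ((hfnn u i).lt_of_ne hne.symm)
    have h1 := coneHull_nonneg (f := dotL (Y - e)) (fun i => by
      rw [dotL_apply, sub_dotProduct, hev]; linarith [hYv i])
      (innerCone_subset H.mem H.point_inner)
    rw [dotL_apply, sub_dotProduct, hew, hY, sub_dotProduct, sum_dotProduct,
      Finset.sum_congr rfl (g := fun _ => (1 : ℝ)) fun u _ => facets_point u.2] at h1
    simp only [Finset.sum_const, hcard, nsmul_eq_mul, mul_one] at h1
    have h2 : (r : ℝ) + d = (n + 1 : ℕ) := by exact_mod_cast hrd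
    linarith
  set T1 : Finset (Fin (n + 1) → ℝ) := J1.map ⟨f, Subtype.val_injective⟩ with hT1
  have hT1mem : ∀ u ∈ T1, u ∈ facets v w := by
    intro u hu
    obtain ⟨l, -, rfl⟩ := Finset.mem_map.1 hu
    exact l.2
  have hT1sum : ∑ u ∈ T1, u = ∑ u ∈ J1, f u := by rw [hT1, Finset.sum_map]; rfl
  have hne1 : ∀ u ∈ T1, u ≠ 0 := by
    rintro u hu rfl
    simpa using facets_point (hT1mem _ hu)
  by_cases hy0 : y = 0
  · refine ⟨T1, ⟨fun u hu => H.facet_mem_lat (hT1mem u hu), fun u hu => facets_nonneg (hT1mem u hu),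
      ?_, fun u hu => (facets_point (hT1mem u hu)).ge, hne1⟩, ?_⟩
    · rw [hT1sum]
      simpa [hy0] using hsplit
    · rw [hy0, zero_dotProduct, add_zero] at hJw
      have : J1.card = r := by exact_mod_cast hJw
      rw [hT1, Finset.card_map, this]
      omega
  · have hyT : y ∉ T1 := by
      intro hmem
      obtain ⟨i, hi⟩ := H.exists_one_le_facet (hT1mem y hmem)
      have h1 := hev i
      rw [← hsplit, ← hT1sum, add_dotProduct, sum_dotProduct] at h1
      have h2 := Finset.single_le_sum (f := fun u => u ⬝ᵥ v i)
        (fun u hu => facets_nonneg (hT1mem u hu) i) hmem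
      linarith
    have hyw1 : 1 ≤ y ⬝ᵥ w := by
      refine one_le_of_int (exists_int_dotProduct hyl H.point_lattice) ?_
      rw [hyw]
      refine lt_of_le_of_ne (Finset.sum_nonneg fun u _ => hc u) fun h => hy0 ?_
      rw [eq_comm, Finset.sum_eq_zero_iff_of_nonneg fun u _ => hc u] at h
      exact Finset.sum_eq_zero fun u hu => by rw [h u hu, zero_smul]
    refine ⟨insert y T1, ⟨?_, ?_, ?_, ?_, ?_⟩, ?_⟩
    · rw [Finset.forall_mem_insert]
      exact ⟨hyl, fun u hu => H.facet_mem_lat (hT1mem u hu)⟩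
    · rw [Finset.forall_mem_insert]
      exact ⟨hynn, fun u hu => facets_nonneg (hT1mem u hu)⟩
    · rw [Finset.sum_insert hyT, hT1sum]
      exact (add_comm _ _).trans hsplit
    · rw [Finset.forall_mem_insert]
      exact ⟨hyw1, fun u hu => (facets_point (hT1mem u hu)).ge⟩
    · rw [Finset.forall_mem_insert]
      exact ⟨hy0, hne1⟩
    · rw [Finset.card_insert_of_notMem hyT, hT1, Finset.card_map]
      have : (r : ℝ) ≤ (J1.card + d : ℕ) := by push_cast; linarith
      have : r ≤ J1.card + d := by exact_mod_cast this
      omega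

end GorPoint

end

section

/-- Simultaneous Dirichlet approximation with prescribed tolerances. -/
lemma exists_dirichlet {ι : Type*} (A : Finset ι) (β : ι → ℝ) (M : ι → ℕ) (hM : ∀ i ∈ A, 0 < M i) :
    ∃ k : ℕ, 1 ≤ k ∧ k ≤ ∏ i ∈ A, M i ∧ ∃ b : ι → ℤ, ∀ i ∈ A, |k * β i - b i| < 1 / M i := by
  classical
  let f : ℕ → ∀ i ∈ A, ℕ := fun k i _ => ⌊Int.fract (k * β i) * M i⌋₊
  have hmaps : ∀ k ∈ Finset.range (∏ i ∈ A, M i + 1),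
      f k ∈ A.pi fun i => Finset.range (M i) := by
    intro k _
    rw [Finset.mem_pi]
    intro i hi
    have hMi : (0 : ℝ) < M i := by exact_mod_cast hM i hi
    rw [Finset.mem_range, Nat.floor_lt (mul_nonneg (Int.fract_nonneg _) hMi.le)]
    exact mul_lt_of_lt_one_left hMi (Int.fract_lt_one _)
  obtain ⟨x, hx, y, hy, hxy, hf⟩ := Finset.exists_ne_map_eq_of_card_lt_of_maps_to
    (by rw [Finset.card_pi, Finset.card_range]; simp) hmaps
  wlog hlt : x < y generalizing x y
  · exact this y hy x hx hxy.symm hf.symm (lt_of_le_of_ne (not_lt.1 hlt) hxy.symm)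
  refine ⟨y - x, by omega, ?_, fun i => ⌊y * β i⌋ - ⌊x * β i⌋, fun i hi => ?_⟩
  · rw [Finset.mem_range] at hy
    omega
  have hMi : (0 : ℝ) < M i := by exact_mod_cast hM i hi
  have h1 : ⌊Int.fract (x * β i) * M i⌋₊ = ⌊Int.fract (y * β i) * M i⌋₊ :=
    congrFun (congrFun hf i) hi
  have hx0 : 0 ≤ Int.fract (x * β i) * M i := mul_nonneg (Int.fract_nonneg _) hMi.le
  have hy0 : 0 ≤ Int.fract (y * β i) * M i := mul_nonneg (Int.fract_nonneg _) hMi.le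
  have hx1 := Nat.floor_le hx0
  have hy1 := Nat.floor_le hy0
  have hx2 := Nat.lt_floor_add_one (Int.fract (x * β i) * M i)
  have hy2 := Nat.lt_floor_add_one (Int.fract (y * β i) * M i)
  rw [h1] at hx1 hx2
  have hx3 := Int.floor_add_fract ((x : ℝ) * β i)
  have hy3 := Int.floor_add_fract ((y : ℝ) * β i)
  have : ((y - x : ℕ) : ℝ) * β i - ((⌊y * β i⌋ - ⌊x * β i⌋ : ℤ) : ℝ)
      = Int.fract (y * β i) - Int.fract (x * β i) := by
    rw [Nat.cast_sub hlt.le]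
    push_cast
    linarith
  rw [this, lt_div_iff₀ hMi, ← abs_of_pos hMi, ← abs_mul, abs_lt]
  constructor <;> linarith

/-- The weights `β` on `S` allow no integral `a` on `S` of total weight `k ≥ 1`, vanishing
somewhere on `S`, with `a i < (k + 1) * β i` throughout. -/
def Rigid {ι : Type*} (S : Finset ι) (β : ι → ℝ) : Prop :=
  ∀ (k : ℕ) (a : ι → ℤ), 1 ≤ k → ∑ i ∈ S, a i = k → (∀ i ∈ S, (a i : ℝ) < (k + 1) * β i) →
    ∀ i ∈ S, a i ≠ 0

lemma Rigid.tail_le {ι : Type*} {S : Finset ι} {β : ι → ℝ} (hR : Rigid S β)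
    (hpos : ∀ i ∈ S, 0 < β i) (hsum : ∑ i ∈ S, β i = 1) [DecidableEq ι] {i0 : ι} {B : Finset ι}
    (hi0 : i0 ∉ B) (hB : insert i0 B ⊂ S) (hmax : ∀ i ∈ S, β i ≤ β i0) :
    ∏ i ∈ insert i0 B, β i ≤ 2 * (3 * B.card) ^ B.card * ∑ i ∈ S \ insert i0 B, β i := by
  set σ := ∑ i ∈ S \ insert i0 B, β i with hσ
  obtain ⟨s, hsS, hsA⟩ := Finset.exists_of_ssubset hB
  have hi0S : i0 ∈ S := hB.1 (Finset.mem_insert_self _ _)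
  have hBS : ∀ i ∈ B, i ∈ S := fun i hi => hB.1 (Finset.mem_insert_of_mem hi)
  have hle1 : ∀ i ∈ S, β i ≤ 1 := fun i hi => by
    rw [← hsum]; exact Finset.single_le_sum (f := β) (fun l hl => (hpos l hl).le) hi
  by_contra! hlt
  set j := B.card with hj
  have hj1 : ∀ i ∈ B, (1 : ℝ) ≤ j := fun i hi => by
    exact_mod_cast Finset.card_pos.2 ⟨i, hi⟩
  have hb0 := hpos i0 hi0S
  let M : ι → ℕ := fun i => ⌈2 * j / β i⌉₊
  have hMpos : ∀ i ∈ B, 0 < M i := fun i hi => by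
    have := hj1 i hi
    have := hpos i (hBS i hi)
    exact Nat.ceil_pos.2 (by positivity)
  have hMlow : ∀ i ∈ B, (1 : ℝ) / M i ≤ β i / (2 * j) := fun i hi => by
    have h1 := hj1 i hi
    have h2 := hpos i (hBS i hi)
    rw [one_div, ← inv_div]
    exact inv_anti₀ (by positivity) (Nat.le_ceil _)
  have hMup : ∀ i ∈ B, (M i : ℝ) ≤ 3 * j / β i := fun i hi => by
    have h1 := hj1 i hi
    have h2 := hpos i (hBS i hi)
    have h3 := hle1 i (hBS i hi)
    have h4 : (M i : ℝ) < 2 * j / β i + 1 := Nat.ceil_lt_add_one (by positivity)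
    have h5 : 1 ≤ j / β i := by rw [le_div_iff₀ h2]; linarith
    have h6 : 3 * (j : ℝ) / β i = 2 * j / β i + j / β i := by ring
    linarith
  obtain ⟨k, hk1, hkM, b, hb⟩ := exists_dirichlet B β M hMpos
  have hgB : 0 < ∏ i ∈ B, β i := Finset.prod_pos fun i hi => hpos i (hBS i hi)
  have hkM' : (k : ℝ) * ∏ i ∈ B, β i ≤ (3 * j) ^ j := by
    have h1 : (k : ℝ) ≤ ∏ i ∈ B, (3 * j / β i) := by
      refine le_trans (by exact_mod_cast hkM) (?_ : ((∏ i ∈ B, M i : ℕ) : ℝ) ≤ _)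
      rw [Nat.cast_prod]
      exact Finset.prod_le_prod (fun _ _ => Nat.cast_nonneg _) hMup
    rw [Finset.prod_div_distrib, Finset.prod_const, le_div_iff₀ hgB] at h1
    exact h1
  have hσ0 : 0 ≤ σ := Finset.sum_nonneg fun i hi => (hpos i (Finset.mem_sdiff.1 hi).1).le
  have hkσ : k * σ < β i0 / 2 := by
    rw [Finset.prod_insert hi0] at hlt
    have h1 : 2 * (k * ∏ i ∈ B, β i) * σ ≤ 2 * (3 * j) ^ j * σ := by gcongr
    have h2 : (2 * (k * σ)) * ∏ i ∈ B, β i < β i0 * ∏ i ∈ B, β i := by linarith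
    have := lt_of_mul_lt_mul_right h2 hgB.le
    linarith
  have hsplit : ∑ i ∈ insert i0 B, β i + σ = 1 := by
    rw [hσ, add_comm, Finset.sum_sdiff hB.1, hsum]
  rw [Finset.sum_insert hi0] at hsplit
  let a : ι → ℤ := fun i => if i = i0 then k - ∑ i ∈ B, b i else if i ∈ B then b i else 0
  have ha0 : a i0 = k - ∑ i ∈ B, b i := by simp [a]
  have haB : ∀ i ∈ B, a i = b i := fun i hi => by
    have : i ≠ i0 := fun h => hi0 (h ▸ hi)
    simp [a, this, hi]
  have hazero : ∀ i, i ∉ insert i0 B → a i = 0 := fun i hi => by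
    rw [Finset.mem_insert, not_or] at hi
    simp [a, hi.1, hi.2]
  refine hR k a hk1 ?_ ?_ s hsS (hazero s hsA)
  · rw [← Finset.sum_subset hB.1 fun i _ hi => hazero i hi, Finset.sum_insert hi0, ha0,
      Finset.sum_congr rfl haB]
    ring
  · intro i hi
    have hbi := hpos i hi
    by_cases hiA : i ∈ insert i0 B
    · rcases Finset.mem_insert.1 hiA with rfl | hiB
      · rw [ha0]
        push_cast
        have h1 : ∑ l ∈ B, (k * β l - b l) ≤ β i / 2 := by
          have h2 : ∀ l ∈ B, (k * β l - b l) ≤ β i / (2 * j) := fun l hl => by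
            have h3 := (abs_lt.1 (hb l hl)).2
            have h4 := hMlow l hl
            have h5 : β l / (2 * j) ≤ β i / (2 * j) := by
              gcongr; exact hmax l (hBS l hl)
            linarith
          refine (Finset.sum_le_card_nsmul _ _ _ h2).trans ?_
          rw [nsmul_eq_mul, ← hj]
          rcases Nat.eq_zero_or_pos j with h0 | h0
          · rw [h0]; simp; linarith
          · have : (0 : ℝ) < j := by exact_mod_cast h0
            apply le_of_eq
            field_simp
        rw [Finset.sum_sub_distrib, ← Finset.mul_sum] at h1
        have h7 : (k : ℝ) * (β i + ∑ l ∈ B, β l + σ) = k := by rw [hsplit, mul_one]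
        nlinarith
      · rw [haB i hiB]
        have h1 := (abs_lt.1 (hb i hiB)).1
        have h2 := hMlow i hiB
        have h3 : β i / (2 * j) ≤ β i := by
          have := hj1 i hiB
          exact div_le_self hbi.le (by linarith)
        linarith
    · rw [hazero i hiA]
      push_cast
      positivity

lemma three_mul_pow_le (j : ℕ) : (3 * j) ^ j ≤ 2 ^ 2 ^ (j + 1) := by
  have h1 : 3 * j ≤ 2 ^ (j + 1) := by
    induction j with
    | zero => simp
    | succ j ih =>
      rcases j with _ | j
      · norm_num
      · have := Nat.one_le_two_pow (n := j)
        simp only [pow_succ] at ih ⊢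
        omega
  have h2 : (j + 1) * j ≤ 2 ^ (j + 1) := by
    clear h1
    induction j with
    | zero => simp
    | succ j ih =>
      have : j < 2 ^ j := Nat.lt_two_pow_self
      rw [pow_succ] at ih ⊢
      rw [pow_succ]
      nlinarith
  calc (3 * j) ^ j ≤ (2 ^ (j + 1)) ^ j := Nat.pow_le_pow_left h1 j
    _ = 2 ^ ((j + 1) * j) := by rw [pow_mul]
    _ ≤ _ := Nat.pow_le_pow_right (by norm_num) h2

/-- The doubly exponential bound for the inverse of a rigid weight. -/
def weightBound (Q : ℕ) : ℕ := (2 * Q * (Q + 1) * 2 ^ Q) ^ 2 ^ Q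

lemma Rigid.le_of_card {ι : Type*} {S : Finset ι} {β : ι → ℝ} (hR : Rigid S β)
    (hpos : ∀ i ∈ S, 0 < β i) (hsum : ∑ i ∈ S, β i = 1) {Q : ℕ} (hQ : 1 ≤ Q)
    (hS : S.card ≤ Q + 1) {i : ι} (hi : i ∈ S) : 1 ≤ β i * weightBound Q := by
  classical
  have hle1 : ∀ i ∈ S, β i ≤ 1 := fun i hi => by
    rw [← hsum]; exact Finset.single_le_sum (f := β) (fun l hl => (hpos l hl).le) hi
  obtain ⟨i0, hi0, hmax⟩ := S.exists_max_image β ⟨i, hi⟩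
  have hQ0 : (1 : ℝ) ≤ Q := by exact_mod_cast hQ
  set c : ℝ := 2 * Q * (Q + 1) with hc
  have hc1 : 1 ≤ c := by nlinarith
  have key : ∀ j, j + 1 ≤ S.card → ∃ B, i0 ∉ B ∧ insert i0 B ⊆ S ∧ B.card = j ∧
      2 * Q ≤ (∏ i ∈ insert i0 B, β i) * (c * 2 ^ j) ^ 2 ^ j := by
    intro j
    induction j with
    | zero =>
      intro _
      refine ⟨∅, by simp, by simpa using hi0, rfl, ?_⟩
      have h1 : 1 ≤ S.card * β i0 := by
        rw [← hsum, ← nsmul_eq_mul]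
        exact Finset.sum_le_card_nsmul _ _ _ hmax
      have h2 : (S.card : ℝ) ≤ Q + 1 := by exact_mod_cast hS
      have h3 := (hpos i0 hi0).le
      have h4 : 1 ≤ (Q + 1) * β i0 := h1.trans (by gcongr)
      simp only [insert_empty_eq, Finset.prod_singleton, pow_zero, mul_one, pow_one, hc]
      nlinarith
    | succ j ih =>
      intro hjS
      obtain ⟨B, hiB, hBS, hcard, hg⟩ := ih (by omega)
      have hss : insert i0 B ⊂ S := by
        refine Finset.ssubset_iff_subset_ne.2 ⟨hBS, fun h => ?_⟩
        have := Finset.card_insert_of_notMem hiB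
        rw [h] at this
        omega
      have htail := hR.tail_le hpos hsum hiB hss hmax
      have hne : (S \ insert i0 B).Nonempty := Finset.sdiff_nonempty.2 fun h => hss.2 h
      obtain ⟨l, hl, hlmax⟩ := Finset.exists_max_image _ β hne
      obtain ⟨hlS, hlB⟩ := Finset.mem_sdiff.1 hl
      have hbl := hpos l hlS
      have hσ : ∑ i ∈ S \ insert i0 B, β i ≤ Q * β l := by
        have h1 := Finset.sum_le_card_nsmul _ _ _ hlmax
        rw [nsmul_eq_mul] at h1
        have h2 : (S \ insert i0 B).card ≤ Q := by
          rw [Finset.card_sdiff_of_subset hBS, Finset.card_insert_of_notMem hiB]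
          omega
        have h3 : ((S \ insert i0 B).card : ℝ) ≤ Q := by exact_mod_cast h2
        exact h1.trans (by gcongr)
      rw [Finset.mem_insert, not_or] at hlB
      refine ⟨insert l B, ?_, ?_, by rw [Finset.card_insert_of_notMem hlB.2, hcard], ?_⟩
      · rw [Finset.mem_insert, not_or]
        exact ⟨Ne.symm hlB.1, hiB⟩
      · rw [Finset.insert_comm]
        exact Finset.insert_subset hlS hBS
      · rw [Finset.insert_comm, Finset.prod_insert (by
          rw [Finset.mem_insert, not_or]; exact hlB)]
        set g := ∏ i ∈ insert i0 B, β i with hgdef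
        have hg0 : 0 < g := Finset.prod_pos fun i hi => hpos i (hBS hi)
        set X := (c * 2 ^ j) ^ 2 ^ j with hX
        have hX0 : 0 < X := by positivity
        have hXs : (c * 2 ^ (j + 1)) ^ 2 ^ (j + 1) = 2 ^ 2 ^ (j + 1) * X ^ 2 := by
          rw [hX, ← pow_mul, ← pow_succ, ← mul_pow, pow_succ 2 j]
          ring
        have h3 : (3 * (j : ℝ)) ^ j ≤ 2 ^ 2 ^ (j + 1) := by exact_mod_cast three_mul_pow_le j
        rw [hcard] at htail
        have h4 : g ≤ 2 * Q * 2 ^ 2 ^ (j + 1) * β l := calc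
          g ≤ 2 * (3 * j) ^ j * (Q * β l) := htail.trans (by gcongr)
          _ ≤ 2 * 2 ^ 2 ^ (j + 1) * (Q * β l) := by gcongr
          _ = _ := by ring
        rw [hXs]
        have h5 : (2 * Q) ^ 2 ≤ (g * X) ^ 2 := by gcongr
        have h6 : g * (g * X ^ 2) ≤ 2 * Q * 2 ^ 2 ^ (j + 1) * β l * (g * X ^ 2) := by gcongr
        have h7 : 2 * (Q : ℝ) * (2 * Q) ≤ 2 * Q * (β l * g * (2 ^ 2 ^ (j + 1) * X ^ 2)) := by
          nlinarith
        exact le_of_mul_le_mul_left h7 (by positivity)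
  have hSpos : 0 < S.card := Finset.card_pos.2 ⟨i, hi⟩
  obtain ⟨B, hiB, hBS, hcard, hg⟩ := key (S.card - 1) (by omega)
  have hBeq : insert i0 B = S := Finset.eq_of_subset_of_card_le hBS (by
    rw [Finset.card_insert_of_notMem hiB]; omega)
  rw [hBeq] at hg
  have hprod : ∏ i ∈ S, β i ≤ β i := by
    rw [← Finset.mul_prod_erase S β hi]
    refine mul_le_of_le_one_right (hpos i hi).le
      (Finset.prod_le_one (fun l hl => ?_) fun l hl => ?_)
    · exact (hpos l (Finset.mem_of_mem_erase hl)).le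
    · exact hle1 l (Finset.mem_of_mem_erase hl)
  have hW : (c * 2 ^ (S.card - 1)) ^ 2 ^ (S.card - 1) ≤ weightBound Q := by
    rw [weightBound]
    push_cast
    rw [← hc]
    have h1 : S.card - 1 ≤ Q := by omega
    have h2 : c * 2 ^ (S.card - 1) ≤ c * 2 ^ Q := by gcongr; norm_num
    have h3 : 1 ≤ c * 2 ^ Q := one_le_mul_of_one_le_of_one_le hc1 (one_le_pow₀ (by norm_num))
    exact (pow_le_pow_left₀ (by positivity) h2 _).trans
      (pow_le_pow_right₀ h3 (Nat.pow_le_pow_right (by norm_num) h1))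
  have h8 : 0 ≤ ∏ i ∈ S, β i := Finset.prod_nonneg fun l hl => (hpos l hl).le
  calc (1 : ℝ) ≤ 2 * Q := by linarith
    _ ≤ _ := hg
    _ ≤ β i * weightBound Q := by
      have := hpos i hi
      gcongr

end

section

variable {n : ℕ} {J : Type*} [Fintype J]

/-- `p` picks, for every part of the decomposition, a vertex of that part. -/
def IsSel (v : J → Fin (n + 1) → ℝ) {T : Finset (Fin (n + 1) → ℝ)} (p : T → J) : Prop :=
  ∀ u : T, u.1 ⬝ᵥ v (p u) = 1

instance fintypeSel (v : J → Fin (n + 1) → ℝ) (T : Finset (Fin (n + 1) → ℝ)) :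
    Fintype {p : T → J // IsSel v p} := Fintype.ofFinite _

/-- The combination of the selected vertices with the same projection as `w`. -/
def selSum (v : J → Fin (n + 1) → ℝ) (w : Fin (n + 1) → ℝ) {T : Finset (Fin (n + 1) → ℝ)}
    (p : T → J) : Fin (n + 1) → ℝ := ∑ u : T, (u.1 ⬝ᵥ w) • v (p u)

/-- The tuple of the values of the functionals in `T`. -/
def partMap (T : Finset (Fin (n + 1) → ℝ)) : (Fin (n + 1) → ℝ) →ₗ[ℝ] (T → ℝ) :=
  LinearMap.pi fun u => dotL u.1

lemma partMap_apply {T : Finset (Fin (n + 1) → ℝ)} (x : Fin (n + 1) → ℝ) (u : T) :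
    partMap T x u = u.1 ⬝ᵥ x := rfl

open GorPoint

namespace CayleyDecomp

variable {v : J → Fin (n + 1) → ℝ} {ξ w : Fin (n + 1) → ℝ} {r : ℕ}
  {T : Finset (Fin (n + 1) → ℝ)}

lemma sum_dot (D : CayleyDecomp v w T) (x : Fin (n + 1) → ℝ) : ∑ u : T, u.1 ⬝ᵥ x = x 0 := by
  rw [← sum_dotProduct, Finset.univ_eq_attach, Finset.sum_attach T (fun u => u), D.sum_eq]
  simp

lemma dot_eq_zero_or_one (H : GorPoint v ξ w r) (D : CayleyDecomp v w T) {u : Fin (n + 1) → ℝ}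
    (hu : u ∈ T) (i : J) : u ⬝ᵥ v i = 0 ∨ u ⬝ᵥ v i = 1 := by
  have h1 := D.sum_dot (v i)
  rw [H.height] at h1
  have h2 : u ⬝ᵥ v i ≤ 1 := by
    rw [← h1]
    exact Finset.single_le_sum (f := fun u : T => u.1 ⬝ᵥ v i) (fun l _ => D.nonneg l.1 l.2 i)
      (Finset.mem_univ ⟨u, hu⟩)
  rcases (D.nonneg u hu i).eq_or_lt with h | h
  · exact Or.inl h.symm
  · exact Or.inr (h2.antisymm (one_le_of_int (exists_int_dotProduct (D.lattice u hu)
      (H.lattice i)) h))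

lemma dot_eq_zero_of_ne (H : GorPoint v ξ w r) (D : CayleyDecomp v w T)
    {u u' : Fin (n + 1) → ℝ} (hu : u ∈ T) (hu' : u' ∈ T) (hne : u' ≠ u) {i : J}
    (hi : u ⬝ᵥ v i = 1) : u' ⬝ᵥ v i = 0 := by
  classical
  have h1 := D.sum_dot (v i)
  rw [H.height] at h1
  have h2 := Finset.sum_le_sum_of_subset_of_nonneg (f := fun u : T => u.1 ⬝ᵥ v i)
    (Finset.subset_univ {⟨u, hu⟩, ⟨u', hu'⟩}) (fun l _ _ => D.nonneg l.1 l.2 i)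
  rw [Finset.sum_pair (by simpa using hne.symm), h1] at h2
  simp only at h2
  have := D.nonneg u' hu' i
  linarith

lemma exists_vertex (H : GorPoint v ξ w r) (D : CayleyDecomp v w T) {u : Fin (n + 1) → ℝ}
    (hu : u ∈ T) : ∃ i, u ⬝ᵥ v i = 1 := by
  obtain ⟨i, hi⟩ := exists_dotProduct_ne_zero H.span (D.ne_zero u hu)
  exact ⟨i, (D.dot_eq_zero_or_one H hu i).resolve_left hi⟩

lemma dot_sum_sel (H : GorPoint v ξ w r) (D : CayleyDecomp v w T) {p : T → J}
    (hp : IsSel v p) (a : T → ℝ) (u : T) : u.1 ⬝ᵥ ∑ l : T, a l • v (p l) = a u := by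
  rw [dotProduct_sum, Finset.sum_eq_single u]
  · rw [dotProduct_smul, hp u]; simp
  · intro l _ hl
    rw [dotProduct_smul, D.dot_eq_zero_of_ne H l.2 u.2 (fun h => hl (Subtype.ext h.symm)) (hp l)]
    simp
  · simp

lemma dot_selSum (H : GorPoint v ξ w r) (D : CayleyDecomp v w T) {p : T → J}
    (hp : IsSel v p) (u : T) : u.1 ⬝ᵥ selSum v w p = u.1 ⬝ᵥ w :=
  D.dot_sum_sel H hp (fun u => u.1 ⬝ᵥ w) u

lemma height_selSum (H : GorPoint v ξ w r) (D : CayleyDecomp v w T) {p : T → J}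
    (hp : IsSel v p) : selSum v w p 0 = r := by
  rw [← D.sum_dot (selSum v w p), Finset.sum_congr rfl fun u _ => D.dot_selSum H hp u, D.sum_dot,
    H.point_height]

lemma selSum_mem_lat (H : GorPoint v ξ w r) (D : CayleyDecomp v w T) (p : T → J) :
    selSum v w p ∈ lat (n + 1) := by
  refine (lat _).sum_mem fun u _ => ?_
  obtain ⟨z, hz⟩ := exists_int_dotProduct (D.lattice u.1 u.2) H.point_lattice
  rw [hz]
  exact intSmul_mem_lat (H.lattice _) z

lemma partMap_surjective (H : GorPoint v ξ w r) (D : CayleyDecomp v w T) :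
    Function.Surjective (partMap T) := by
  intro a
  choose p hp using fun u : T => D.exists_vertex H u.2
  exact ⟨∑ l : T, a l • v (p l), funext fun u => D.dot_sum_sel H hp a u⟩

lemma finrank_ker (H : GorPoint v ξ w r) (D : CayleyDecomp v w T) :
    Module.finrank ℝ (LinearMap.ker (partMap T)) + T.card = n + 1 := by
  have h := LinearMap.finrank_range_add_finrank_ker (partMap T)
  rw [LinearMap.range_eq_top.2 (D.partMap_surjective H), finrank_top] at h
  simp only [Module.finrank_fintype_fun_eq_card, Fintype.card_coe, Fintype.card_fin] at h
  omega

lemma mem_coneHull_selSum (H : GorPoint v ξ w r) (D : CayleyDecomp v w T)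
    {x : Fin (n + 1) → ℝ} (hx : x ∈ coneHull v) {t : ℝ} (ht : ∀ u ∈ T, u ⬝ᵥ x = t * (u ⬝ᵥ w)) :
    x ∈ coneHull fun p : {p : T → J // IsSel v p} => selSum v w p.1 := by
  classical
  have hr : (0 : ℝ) < r := by exact_mod_cast H.pos
  have hx0 : x 0 = t * r := by
    rw [← D.sum_dot x, Finset.sum_congr rfl fun u _ => ht u.1 u.2, ← Finset.mul_sum, D.sum_dot,
      H.point_height]
  have h0 := height_nonneg H.height hx
  rw [hx0] at h0
  rcases (nonneg_of_mul_nonneg_left h0 hr).eq_or_lt with rfl | htpos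
  · rw [eq_zero_of_height H.height hx (by rw [hx0, zero_mul])]
    exact zero_mem_coneHull _
  obtain ⟨c, hc, rfl⟩ := hx
  let A : T → Set (Fin (n + 1) → ℝ) := fun u => {y | ∃ i, u.1 ⬝ᵥ v i = 1 ∧ y = (u.1 ⬝ᵥ w) • v i}
  have hfil : ∀ (u : T) (f : J → ℝ), ∑ i with u.1 ⬝ᵥ v i = 1, f i = ∑ i, f i * (u.1 ⬝ᵥ v i) := by
    intro u f
    rw [Finset.sum_filter]
    refine Finset.sum_congr rfl fun i _ => ?_
    rcases D.dot_eq_zero_or_one H u.2 i with h | h <;> simp [h]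
  have hmem : ∑ u : T, ∑ i with u.1 ⬝ᵥ v i = 1, (c i / t) • v i ∈ convexHull ℝ (∑ u : T, A u) := by
    rw [convexHull_sum, Set.mem_fintype_sum]
    refine ⟨_, fun u => ?_, rfl⟩
    have huw : 0 < u.1 ⬝ᵥ w := one_pos.trans_le (D.point u.1 u.2)
    have : ∑ i with u.1 ⬝ᵥ v i = 1, (c i / t) • v i
        = ∑ i with u.1 ⬝ᵥ v i = 1, (c i / (t * (u.1 ⬝ᵥ w))) • ((u.1 ⬝ᵥ w) • v i) := by
      refine Finset.sum_congr rfl fun i _ => ?_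
      rw [smul_smul]
      congr 1
      field_simp
    rw [this]
    refine (convex_convexHull ℝ _).sum_mem (fun i _ => div_nonneg (hc i) (by positivity)) ?_
      fun i hi => subset_convexHull ℝ _ ⟨i, (Finset.mem_filter.1 hi).2, rfl⟩
    rw [← Finset.sum_div, hfil, div_eq_one_iff_eq (by positivity), ← ht u.1 u.2, dotProduct_sum]
    refine Finset.sum_congr rfl fun i _ => ?_
    rw [dotProduct_smul, smul_eq_mul]
  have hsub : convexHull ℝ (∑ u : T, A u) ⊆
      coneHull fun p : {p : T → J // IsSel v p} => selSum v w p.1 := by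
    refine convexHull_min (fun y hy => ?_) (convex_coneHull _)
    rw [Set.mem_fintype_sum] at hy
    obtain ⟨g, hg, rfl⟩ := hy
    choose p hp hgp using hg
    have : ∑ u : T, g u = selSum v w p := Finset.sum_congr rfl fun u _ => hgp u
    rw [this]
    exact mem_coneHull (fun p : {p : T → J // IsSel v p} => selSum v w p.1) ⟨p, hp⟩
  have heq : ∑ i, c i • v i = t • ∑ u : T, ∑ i with u.1 ⬝ᵥ v i = 1, (c i / t) • v i := by
    ext k
    simp only [Finset.sum_apply, Pi.smul_apply, smul_eq_mul, hfil]
    rw [Finset.sum_comm, Finset.mul_sum]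
    refine Finset.sum_congr rfl fun i _ => ?_
    rw [← Finset.mul_sum, D.sum_dot, H.height]
    field_simp
  rw [heq]
  exact coneHull_smul htpos.le (hsub hmem)

/-- The values of the facet functionals at the combinations `selSum v w p` are bounded. -/
lemma facet_selSum_le (H : GorPoint v ξ w r) (D : CayleyDecomp v w T) {Q : ℕ} (hQ : 1 ≤ Q)
    (hT : n + 1 ≤ T.card + Q) {p : T → J} (hp : IsSel v p) {l : Fin (n + 1) → ℝ}
    (hl : l ∈ facets v w) : l ⬝ᵥ selSum v w p ≤ weightBound Q := by
  classical
  have hr : (0 : ℝ) < r := by exact_mod_cast H.pos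
  let y : {p : T → J // IsSel v p} → Fin (n + 1) → ℝ := fun p => selSum v w p.1
  have hyl : ∀ {l}, l ∈ facets v w → ∀ s, 0 ≤ l ⬝ᵥ y s := fun {l} hl s => by
    simp only [y, selSum, dotProduct_sum, dotProduct_smul, smul_eq_mul]
    exact Finset.sum_nonneg fun u _ =>
      mul_nonneg (zero_le_one.trans (D.point u.1 u.2)) (facets_nonneg hl _)
  obtain ⟨ε, hε, h1⟩ := H.isInner_point (-selSum v w p)
  obtain ⟨γ, hγ, hγs⟩ := D.mem_coneHull_selSum H h1 (t := 1 - ε) fun u hu => by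
    rw [dotProduct_add, dotProduct_smul, dotProduct_neg, D.dot_selSum H hp ⟨u, hu⟩]
    simp only [smul_eq_mul]
    ring
  have hys : ∀ s, y s 0 = r := fun s => D.height_selSum H s.2
  obtain ⟨β, hβ, hβs, hβp, hli⟩ := exists_linearIndepOn_support (v := y) (e := ht n)
    (fun s => by rw [ht, LinearMap.proj_apply, hys]; exact hr)
    (fun s => γ s + if s = ⟨p, hp⟩ then ε else 0)
    (fun s => add_nonneg (hγ s) (by split_ifs <;> positivity)) ⟨p, hp⟩ (by
      rw [if_pos rfl]; exact add_pos_of_nonneg_of_pos (hγ _) hε)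
  have hβw : ∑ s, β s • y s = w := by
    rw [hβs]
    simp only [add_smul, Finset.sum_add_distrib, ite_smul, zero_smul, Finset.sum_ite_eq',
      Finset.mem_univ, if_true]
    rw [show ∑ s, γ s • y s = w + ε • -selSum v w p from hγs]
    simp [y]
  set S := Finset.univ.filter fun s => β s ≠ 0 with hS
  have hScoe : {s | β s ≠ 0} = (S : Set _) := by ext; simp [hS]
  rw [hScoe] at hli
  have hβpos : ∀ s ∈ S, 0 < β s := fun s hs =>
    (hβ s).lt_of_ne (Finset.mem_filter.1 hs).2.symm
  have hSsum : ∀ f : {p : T → J // IsSel v p} → Fin (n + 1) → ℝ,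
      ∑ s ∈ S, β s • f s = ∑ s, β s • f s := fun f => by
    rw [hS, Finset.sum_filter]
    refine Finset.sum_congr rfl fun s _ => ?_
    split_ifs with h
    · rfl
    · rw [not_not.1 h, zero_smul]
  have hpS : (⟨p, hp⟩ : {p : T → J // IsSel v p}) ∈ S := by simp [hS, hβp.ne']
  have hβw' : ∑ s ∈ S, β s • y s = w := (hSsum y).trans hβw
  have hsum : ∑ s ∈ S, β s = 1 := by
    have h2 := congrFun hβw' 0
    simp only [Finset.sum_apply, Pi.smul_apply, smul_eq_mul, hys, H.point_height] at h2
    rw [← Finset.sum_mul] at h2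
    exact mul_right_cancel₀ hr.ne' (h2.trans (one_mul _).symm)
  have hcard : S.card ≤ Q + 1 := by
    have h2 := finrank_span_eq_card hli.linearIndependent
    have h3 : Submodule.span ℝ (Set.range fun s : (S : Set {p : T → J // IsSel v p}) => y s) ≤
        LinearMap.ker (partMap T) ⊔ Submodule.span ℝ {y ⟨p, hp⟩} := by
      rw [Submodule.span_le]
      rintro _ ⟨s, rfl⟩
      refine Submodule.mem_sup.2 ⟨y s - y ⟨p, hp⟩, ?_, y ⟨p, hp⟩, Submodule.mem_span_singleton_self _,
        by simp⟩
      rw [LinearMap.mem_ker]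
      ext u
      rw [map_sub, Pi.sub_apply, partMap_apply, partMap_apply, D.dot_selSum H s.1.2,
        D.dot_selSum H hp]
      simp
    have h4 := Submodule.finrank_mono h3
    have h5 := Submodule.finrank_add_le_finrank_add_finrank (LinearMap.ker (partMap T))
      (Submodule.span ℝ {y ⟨p, hp⟩})
    have h6 : Module.finrank ℝ (Submodule.span ℝ {y ⟨p, hp⟩}) ≤ 1 := by
      simpa using finrank_span_le_card (R := ℝ) ({y ⟨p, hp⟩} : Set (Fin (n + 1) → ℝ))
    have h7 := D.finrank_ker H
    have h8 : Fintype.card (S : Set {p : T → J // IsSel v p}) = S.card := by simp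
    rw [h2, h8] at h4
    omega
  have hrigid : Rigid S β := by
    intro k a hk hak ha s hs has
    set x := ∑ i ∈ S, ((k + 1) * β i - a i) • y i with hx
    have hx' : x = ((k + 1 : ℕ) : ℝ) • w - ∑ i ∈ S, (a i : ℝ) • y i := by
      rw [hx, ← hβw', Finset.smul_sum, ← Finset.sum_sub_distrib]
      refine Finset.sum_congr rfl fun i _ => ?_
      rw [sub_smul, smul_smul]
      push_cast
      rfl
    have hxl : x ∈ lat (n + 1) := by
      rw [hx']
      exact (lat _).sub_mem (natSmul_mem_lat H.point_lattice _)
        ((lat _).sum_mem fun i _ => intSmul_mem_lat (D.selSum_mem_lat H _) _)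
    have hxin : x ∈ innerCone v ξ := by
      refine H.mem_innerCone_of_facets_pos fun u hu => ?_
      obtain ⟨i, hi, hpos⟩ : ∃ i ∈ S, 0 < u ⬝ᵥ y i := by
        by_contra! h
        have h2 := facets_point hu
        rw [← hβw', dotProduct_sum, Finset.sum_eq_zero fun i hi => by
          rw [dotProduct_smul, le_antisymm (h i hi) (hyl hu i), smul_zero]] at h2
        exact zero_ne_one h2
      rw [hx, dotProduct_sum]
      refine Finset.sum_pos' (fun i hi => ?_) ⟨i, hi, ?_⟩
      · rw [dotProduct_smul]
        exact mul_nonneg (sub_pos.2 (ha i hi)).le (hyl hu i)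
      · rw [dotProduct_smul]
        exact mul_pos (sub_pos.2 (ha i hi)) hpos
    have hx0 : (x - w) 0 = 0 := by
      rw [hx']
      simp only [Pi.sub_apply, Finset.sum_apply, Pi.smul_apply, smul_eq_mul, hys, H.point_height]
      rw [← Finset.sum_mul]
      have : ∑ i ∈ S, (a i : ℝ) = k := by exact_mod_cast hak
      rw [this]
      push_cast
      ring
    have hxw := eq_zero_of_height H.height (H.sub_mem x hxl hxin) hx0
    rw [linearIndepOn_finset_iff] at hli
    have h2 := hli (fun i => k * β i - a i) (by
      rw [← hxw, hx]
      nth_rewrite 1 [← hβw']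
      rw [← Finset.sum_sub_distrib]
      refine Finset.sum_congr rfl fun i _ => ?_
      rw [← sub_smul]
      congr 1
      ring) s hs
    rw [has] at h2
    have hk' : (0 : ℝ) < k := by exact_mod_cast hk
    have := mul_pos hk' (hβpos s hs)
    simp at h2
    rcases h2 with h2 | h2
    · omega
    · exact (hβpos s hs).ne' h2
  have h2 := hrigid.le_of_card hβpos hsum hQ hcard hpS
  have h3 : β ⟨p, hp⟩ * (l ⬝ᵥ selSum v w p) ≤ 1 := by
    rw [← facets_point hl]
    nth_rewrite 2 [← hβw]
    rw [dotProduct_sum]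
    refine le_trans ?_ (Finset.single_le_sum (f := fun s => l ⬝ᵥ (β s • y s)) (fun s _ => ?_)
      (Finset.mem_univ ⟨p, hp⟩))
    · simp [y]
    · rw [dotProduct_smul]
      exact mul_nonneg (hβ s) (hyl hl s)
  have h4 : 0 ≤ l ⬝ᵥ selSum v w p := hyl hl ⟨p, hp⟩
  have h5 : (0 : ℝ) ≤ weightBound Q := Nat.cast_nonneg _
  nlinarith

end CayleyDecomp

end

section

open GorPoint

variable {n : ℕ} {J : Type*} [Fintype J]

/-- Vectors of a submodule of `ℤ ^ N` which are pairwise incongruent modulo `k` times the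
submodule are at most `k ^ rank` in number. -/
lemma card_le_of_incongruent {N : ℕ} (L : Submodule ℤ (Fin N → ℤ)) {k : ℕ} (hk : 0 < k)
    {ι : Type*} (s : Finset ι) (f : ι → L)
    (hf : ∀ i ∈ s, ∀ j ∈ s, ∀ z : L, f i - f j = (k : ℤ) • z → i = j) :
    s.card ≤ k ^ Module.finrank ℤ L := by
  classical
  have : NeZero k := ⟨hk.ne'⟩
  let b := Module.finBasis ℤ L
  let g : ι → Fin (Module.finrank ℤ L) → ZMod k := fun i l => (b.repr (f i) l : ZMod k)
  have hinj : Set.InjOn g s := by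
    intro i hi j hj hij
    have h : ∀ l, ∃ c : ℤ, b.repr (f i) l - b.repr (f j) l = k * c := fun l =>
      (ZMod.intCast_eq_intCast_iff_dvd_sub _ _ k).1 (congrFun hij l).symm
    choose c hc using h
    refine hf i hi j hj (∑ l, c l • b l) (b.repr.injective ?_)
    ext l
    rw [map_sub, map_smul, Finsupp.sub_apply, Finsupp.smul_apply, b.repr_sum_self]
    simpa using hc l
  have h1 := Finset.card_le_card_of_injOn g (t := Finset.univ) (fun _ _ => Finset.mem_univ _) hinj
  simpa [Finset.card_univ, ZMod.card] using h1

namespace CayleyDecomp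

variable {v : J → Fin (n + 1) → ℝ} {ξ w : Fin (n + 1) → ℝ} {r : ℕ}
  {T : Finset (Fin (n + 1) → ℝ)}

lemma card_le_of_incongruent (H : GorPoint v ξ w r) (D : CayleyDecomp v w T) {k : ℕ}
    (hk : 0 < k) {ι : Type*} (s : Finset ι) (f : ι → Fin (n + 1) → ℝ)
    (hfl : ∀ i ∈ s, f i ∈ lat (n + 1)) (hfk : ∀ i ∈ s, ∀ u ∈ T, u ⬝ᵥ f i = 0)
    (hf : ∀ i ∈ s, ∀ j ∈ s, ∀ z ∈ lat (n + 1), (∀ u ∈ T, u ⬝ᵥ z = 0) →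
      f i - f j = (k : ℝ) • z → i = j) :
    s.card ≤ k ^ (n + 1 - T.card) := by
  classical
  have hcast : ∀ (x y : Fin (n + 1) → ℤ),
      ((x ⬝ᵥ y : ℤ) : ℝ) = (fun i => (x i : ℝ)) ⬝ᵥ fun i => (y i : ℝ) := fun x y => by
    simp [dotProduct]
  choose U hU using fun u : T => mem_lat_iff_exists.1 (D.lattice u.1 u.2)
  choose V hV using fun i => mem_lat_iff_exists.1 (H.lattice i)
  choose p hp using fun u : T => D.exists_vertex H u.2
  let φ : (Fin (n + 1) → ℤ) →ₗ[ℤ] (T → ℤ) :=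
    LinearMap.pi fun u => dotProductEquiv ℤ (Fin (n + 1)) (U u)
  have hφ : ∀ z u, φ z u = U u ⬝ᵥ z := fun _ _ => rfl
  have hφr : ∀ z (u : T), ((φ z u : ℤ) : ℝ) = u.1 ⬝ᵥ fun i => (z i : ℝ) := fun z u => by
    rw [hφ, hcast, hU]
  have hsurj : Function.Surjective φ := by
    intro a
    refine ⟨∑ l : T, a l • V (p l), funext fun u => ?_⟩
    have h1 := hφr (∑ l : T, a l • V (p l)) u
    have h2 : (fun i => (((∑ l : T, a l • V (p l)) i : ℤ) : ℝ))
        = ∑ l : T, (a l : ℝ) • v (p l) := by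
      ext i
      simp [← hV]
    rw [h2, D.dot_sum_sel H hp] at h1
    exact_mod_cast h1
  have hrank : Module.finrank ℤ (LinearMap.ker φ) = n + 1 - T.card := by
    have h := (LinearMap.ker φ).finrank_quotient_add_finrank
    rw [(φ.quotKerEquivOfSurjective hsurj).finrank_eq] at h
    simp only [Module.finrank_fintype_fun_eq_card, Fintype.card_coe, Fintype.card_fin] at h
    omega
  have hex : ∀ i : s, ∃ z : LinearMap.ker φ, (fun l => ((z : Fin (n + 1) → ℤ) l : ℝ)) = f i := by
    intro i
    obtain ⟨z, hz⟩ := mem_lat_iff_exists.1 (hfl i.1 i.2)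
    refine ⟨⟨z, ?_⟩, hz⟩
    rw [LinearMap.mem_ker]
    ext u
    have h1 := hφr z u
    rw [hz, hfk i.1 i.2 u.1 u.2] at h1
    exact_mod_cast h1
  choose F hF using hex
  rw [← hrank, ← Finset.card_attach]
  refine GorensteinCone.card_le_of_incongruent _ hk s.attach F fun i _ j _ z hz => ?_
  refine Subtype.ext (hf i.1 i.2 j.1 j.2 _ (intCast_mem_lat z.1) (fun u hu => ?_) ?_)
  · rw [← hφr z.1 ⟨u, hu⟩, LinearMap.mem_ker.1 z.2]
    simp
  · rw [← hF, ← hF]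
    ext l
    have := congrFun (congrArg Subtype.val hz) l
    simp only [Submodule.coe_sub, Pi.sub_apply, Submodule.coe_smul, Pi.smul_apply,
      smul_eq_mul] at this
    simp only [Pi.sub_apply, Pi.smul_apply, smul_eq_mul]
    exact_mod_cast this

lemma eq_zero_of_neg_one_lt (H : GorPoint v ξ w r) (D : CayleyDecomp v w T)
    {z : Fin (n + 1) → ℝ} (hz : z ∈ lat (n + 1)) (hzT : ∀ u ∈ T, u ⬝ᵥ z = 0)
    (hl : ∀ l ∈ facets v w, -1 < l ⬝ᵥ z) : z = 0 := by
  have h0 : z 0 = 0 := by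
    rw [← D.sum_dot z]
    exact Finset.sum_eq_zero fun u _ => hzT u.1 u.2
  have hin : w + z ∈ innerCone v ξ := H.mem_innerCone_of_facets_pos fun l hlf => by
    rw [dotProduct_add, facets_point hlf]
    linarith [hl l hlf]
  have h1 := H.sub_mem _ ((lat _).add_mem H.point_lattice hz) hin
  rw [add_sub_cancel_left] at h1
  exact eq_zero_of_height H.height h1 h0

/-- The sum over the parts of the maximal values of a facet functional is bounded. -/
lemma sum_facet_le (H : GorPoint v ξ w r) (D : CayleyDecomp v w T) {Q : ℕ} (hQ : 1 ≤ Q)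
    (hT : n + 1 ≤ T.card + Q) {p : T → J} (hp : IsSel v p) {l : Fin (n + 1) → ℝ}
    (hl : l ∈ facets v w) (I : Finset T) : ∑ u ∈ I, l ⬝ᵥ v (p u) ≤ weightBound Q := by
  refine le_trans ?_ (D.facet_selSum_le H hQ hT hp hl)
  rw [selSum, dotProduct_sum]
  refine (Finset.sum_le_sum_of_subset_of_nonneg (Finset.subset_univ I)
    fun u _ _ => facets_nonneg hl _).trans (Finset.sum_le_sum fun u _ => ?_)
  rw [dotProduct_smul, smul_eq_mul]
  exact le_mul_of_one_le_left (facets_nonneg hl _) (D.point u.1 u.2)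

open Classical in
/-- The parts with at least two vertices. -/
def bigParts (v : J → Fin (n + 1) → ℝ) (T : Finset (Fin (n + 1) → ℝ)) : Finset T :=
  Finset.univ.filter fun u => ∃ i i', u.1 ⬝ᵥ v i = 1 ∧ u.1 ⬝ᵥ v i' = 1 ∧ v i ≠ v i'

lemma card_bigParts_lt (H : GorPoint v ξ w r) (D : CayleyDecomp v w T) {Q : ℕ} (hQ : 1 ≤ Q)
    (hT : n + 1 ≤ T.card + Q) :
    (bigParts v T).card + 1 ≤ (weightBound Q + 1) ^ (n + 1 - T.card) := by
  classical
  have hex : ∀ u : T, ∃ i i', u.1 ⬝ᵥ v i = 1 ∧ u.1 ⬝ᵥ v i' = 1 ∧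
      (u ∈ bigParts v T → toLex (v i) < toLex (v i')) := by
    intro u
    by_cases hu : u ∈ bigParts v T
    · obtain ⟨i, i', h1, h2, h3⟩ := (Finset.mem_filter.1 hu).2
      rcases lt_or_gt_of_ne
        (fun h => h3 (toLex.injective h) : toLex (v i) ≠ toLex (v i')) with h | h
      · exact ⟨i, i', h1, h2, fun _ => h⟩
      · exact ⟨i', i, h2, h1, fun _ => h⟩
    · obtain ⟨i, hi⟩ := D.exists_vertex H u.2
      exact ⟨i, i, hi, hi, fun h => absurd h hu⟩
  choose p p' hp hp' hlt using hex
  let z : T → Fin (n + 1) → ℝ := fun u => v (p' u) - v (p u)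
  have hzl : ∀ u, z u ∈ lat (n + 1) := fun u => (lat _).sub_mem (H.lattice _) (H.lattice _)
  have hzT : ∀ u, ∀ u' ∈ T, u' ⬝ᵥ z u = 0 := by
    intro u u' hu'
    rw [dotProduct_sub]
    by_cases h : u' = u.1
    · rw [h, hp, hp', sub_self]
    · rw [D.dot_eq_zero_of_ne H u.2 hu' h (hp u), D.dot_eq_zero_of_ne H u.2 hu' h (hp' u), sub_self]
  have key : ∀ I ⊆ bigParts v T, ∀ y ∈ lat (n + 1), (∀ u ∈ T, u ⬝ᵥ y = 0) →
      ∑ u ∈ I, z u = ((weightBound Q + 1 : ℕ) : ℝ) • y → I = ∅ := by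
    intro I hI y hyl hyT hy
    by_contra hne
    have hy0 : y = 0 := D.eq_zero_of_neg_one_lt H hyl hyT fun l hl => by
      have h1 : -(weightBound Q : ℝ) ≤ l ⬝ᵥ ∑ u ∈ I, z u := by
        rw [dotProduct_sum]
        have h2 := D.sum_facet_le H hQ hT hp hl I
        have h3 : ∑ u ∈ I, -(l ⬝ᵥ v (p u)) ≤ ∑ u ∈ I, l ⬝ᵥ z u := by
          refine Finset.sum_le_sum fun u _ => ?_
          rw [dotProduct_sub]
          linarith [facets_nonneg hl (p' u)]
        rw [Finset.sum_neg_distrib] at h3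
        linarith
      rw [hy, dotProduct_smul, smul_eq_mul] at h1
      push_cast at h1
      have h4 : (0 : ℝ) ≤ weightBound Q := Nat.cast_nonneg _
      by_contra! h5
      nlinarith
    rw [hy0, smul_zero] at hy
    have h2 : ∑ u ∈ I, toLex (v (p u)) < ∑ u ∈ I, toLex (v (p' u)) :=
      Finset.sum_lt_sum_of_nonempty (Finset.nonempty_iff_ne_empty.2 hne) fun u hu => hlt u (hI hu)
    have h3 : ∑ u ∈ I, v (p' u) = ∑ u ∈ I, v (p u) := by
      rw [← sub_eq_zero, ← Finset.sum_sub_distrib]; exact hy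
    exact h2.ne' h3
  let e := (bigParts v T).equivFin
  let I : ℕ → Finset T := fun t => (bigParts v T).filter fun u =>
    ∃ h : u ∈ bigParts v T, (e ⟨u, h⟩ : ℕ) < t
  have hmono : ∀ {s t}, s ≤ t → I s ⊆ I t := fun {s t} hst u hu => by
    obtain ⟨h1, h2, h3⟩ := Finset.mem_filter.1 hu
    exact Finset.mem_filter.2 ⟨h1, h2, h3.trans_le hst⟩
  have hstep : ∀ {s t}, s < t → t < (bigParts v T).card + 1 → ∀ y ∈ lat (n + 1),
      (∀ u ∈ T, u ⬝ᵥ y = 0) →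
      ∑ u ∈ I t, z u - ∑ u ∈ I s, z u ≠ ((weightBound Q + 1 : ℕ) : ℝ) • y := by
    intro s t hst ht y hyl hyT hy
    rw [← Finset.sum_sdiff (hmono hst.le), add_sub_cancel_right] at hy
    have h1 := key _ (Finset.sdiff_subset.trans (Finset.filter_subset _ _)) y hyl hyT hy
    let u := e.symm ⟨s, by omega⟩
    have h2 : u.1 ∈ I t \ I s := by
      rw [Finset.mem_sdiff]
      refine ⟨Finset.mem_filter.2 ⟨u.2, u.2, by simpa [u] using hst⟩, fun h => ?_⟩
      obtain ⟨_, _, h3⟩ := Finset.mem_filter.1 h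
      simp [u] at h3
    rw [h1] at h2
    exact absurd h2 (Finset.notMem_empty _)
  have hcard := D.card_le_of_incongruent H (Nat.succ_pos (weightBound Q))
    (Finset.range ((bigParts v T).card + 1)) (fun t => ∑ u ∈ I t, z u)
    (fun t _ => (lat _).sum_mem fun u _ => hzl u)
    (fun t _ u hu => by
      rw [dotProduct_sum]; exact Finset.sum_eq_zero fun l _ => hzT l u hu)
    (fun s hs t ht y hyl hyT hy => by
      rw [Finset.mem_range] at hs ht
      rcases lt_trichotomy s t with h | h | h
      · refine absurd ?_ (hstep h ht (-y) ((lat _).neg_mem hyl) fun u hu => by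
          rw [dotProduct_neg, hyT u hu, neg_zero])
        rw [smul_neg, ← neg_sub]
        exact congrArg _ hy
      · exact h
      · exact absurd hy (hstep h hs y hyl hyT))
  rwa [Finset.card_range] at hcard

end CayleyDecomp

end

section

open GorPoint

variable {n : ℕ} {J : Type*} [Fintype J]

namespace CayleyDecomp

variable {v : J → Fin (n + 1) → ℝ} {ξ w : Fin (n + 1) → ℝ} {r : ℕ}
  {T : Finset (Fin (n + 1) → ℝ)}

lemma exists_maximal_sel (H : GorPoint v ξ w r) (D : CayleyDecomp v w T)
    (l : Fin (n + 1) → ℝ) :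
    ∃ p : T → J, IsSel v p ∧ ∀ (u : T) i, u.1 ⬝ᵥ v i = 1 → l ⬝ᵥ v i ≤ l ⬝ᵥ v (p u) := by
  classical
  have hex : ∀ u : T, ∃ i, u.1 ⬝ᵥ v i = 1 ∧ ∀ i', u.1 ⬝ᵥ v i' = 1 → l ⬝ᵥ v i' ≤ l ⬝ᵥ v i := by
    intro u
    obtain ⟨i, hi⟩ := D.exists_vertex H u.2
    obtain ⟨i', hi', hmax⟩ := Finset.exists_max_image
      (Finset.univ.filter fun i => u.1 ⬝ᵥ v i = 1) (fun i => l ⬝ᵥ v i) ⟨i, by simpa using hi⟩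
    exact ⟨i', (Finset.mem_filter.1 hi').2, fun i'' h => hmax i'' (by simpa using h)⟩
  choose p hp hmax using hex
  exact ⟨p, hp, hmax⟩

/-- The value of a facet functional on a point of the cone, split into the contributions of the
parts. -/
lemma exists_dot_eq_sum (H : GorPoint v ξ w r) (D : CayleyDecomp v w T) {p : T → J}
    (hp : IsSel v p) {l : Fin (n + 1) → ℝ} (hl : l ∈ facets v w)
    (hmax : ∀ (u : T) i, u.1 ⬝ᵥ v i = 1 → l ⬝ᵥ v i ≤ l ⬝ᵥ v (p u))
    {x : Fin (n + 1) → ℝ} (hx : x ∈ coneHull v) :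
    ∃ g : T → ℝ, l ⬝ᵥ x = ∑ u, g u ∧ (∀ u, 0 ≤ g u) ∧
      (∀ u : T, g u ≤ (u.1 ⬝ᵥ x) * (l ⬝ᵥ v (p u))) ∧
      ∀ u ∉ bigParts v T, g u = (u.1 ⬝ᵥ x) * (l ⬝ᵥ v (p u)) := by
  classical
  obtain ⟨c, hc, rfl⟩ := hx
  have hdot : ∀ u : Fin (n + 1) → ℝ, u ⬝ᵥ ∑ i, c i • v i = ∑ i, c i * (u ⬝ᵥ v i) := fun u => by
    rw [dotProduct_sum]
    exact Finset.sum_congr rfl fun i _ => by rw [dotProduct_smul, smul_eq_mul]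
  refine ⟨fun u => ∑ i, c i * (u.1 ⬝ᵥ v i) * (l ⬝ᵥ v i), ?_, fun u => ?_, fun u => ?_,
    fun u hu => ?_⟩
  · rw [hdot, Finset.sum_comm]
    refine Finset.sum_congr rfl fun i _ => ?_
    rw [← Finset.sum_mul, ← Finset.mul_sum, D.sum_dot, H.height, mul_one]
  · exact Finset.sum_nonneg fun i _ =>
      mul_nonneg (mul_nonneg (hc i) (D.nonneg u.1 u.2 i)) (facets_nonneg hl i)
  · rw [hdot, Finset.sum_mul]
    refine Finset.sum_le_sum fun i _ => ?_
    rcases D.dot_eq_zero_or_one H u.2 i with h | h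
    · simp [h]
    · exact mul_le_mul_of_nonneg_left (hmax u i h)
        (mul_nonneg (hc i) (D.nonneg u.1 u.2 i))
  · rw [hdot, Finset.sum_mul]
    refine Finset.sum_congr rfl fun i _ => ?_
    rcases D.dot_eq_zero_or_one H u.2 i with h | h
    · simp [h]
    · have h1 : v i = v (p u) := by
        by_contra hne
        exact hu (Finset.mem_filter.2 ⟨Finset.mem_univ _, i, p u, h, hp u, hne⟩)
      rw [h1]

lemma card_fibre_le (H : GorPoint v ξ w r) (D : CayleyDecomp v w T) {Q : ℕ} (hQ : 1 ≤ Q)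
    (hT : n + 1 ≤ T.card + Q) {a : T → ℕ} {A : ℕ} (hA : ∀ u ∈ bigParts v T, a u ≤ A)
    (s : Finset (Fin (n + 1) → ℝ)) (hsl : ∀ x ∈ s, x ∈ lat (n + 1))
    (hsc : ∀ x ∈ s, x ∈ coneHull v) (hsa : ∀ x ∈ s, ∀ u : T, u.1 ⬝ᵥ x = a u) :
    s.card ≤ (1 + weightBound Q * A) ^ (n + 1 - T.card) := by
  classical
  choose p₀ hp₀ using fun u : T => D.exists_vertex H u.2
  refine D.card_le_of_incongruent H (by omega) s (fun x => x - ∑ u : T, (a u : ℝ) • v (p₀ u))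
    (fun x hx => (lat _).sub_mem (hsl x hx)
      ((lat _).sum_mem fun u _ => natSmul_mem_lat (H.lattice _) _))
    (fun x hx u hu => ?_) (fun x hx y hy z hz hzT h => ?_)
  · rw [dotProduct_sub, hsa x hx ⟨u, hu⟩,
      D.dot_sum_sel H hp₀ (fun u => (a u : ℝ)) ⟨u, hu⟩, sub_self]
  · rw [sub_sub_sub_cancel_right] at h
    have hz0 : z = 0 := D.eq_zero_of_neg_one_lt H hz hzT fun l hl => by
      obtain ⟨p, hp, hmax⟩ := D.exists_maximal_sel H l
      obtain ⟨g, hg, hg0, hgle, hgeq⟩ := D.exists_dot_eq_sum H hp hl hmax (hsc x hx)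
      obtain ⟨g', hg', hg'0, hg'le, hg'eq⟩ := D.exists_dot_eq_sum H hp hl hmax (hsc y hy)
      have h1 : ∀ u : T, (if u ∈ bigParts v T then -(A * (l ⬝ᵥ v (p u))) else 0) ≤ g u - g' u := by
        intro u
        split_ifs with hu
        · have h2 := hg'le u
          rw [hsa y hy] at h2
          have h3 : (a u : ℝ) * (l ⬝ᵥ v (p u)) ≤ A * (l ⬝ᵥ v (p u)) :=
            mul_le_mul_of_nonneg_right (by exact_mod_cast hA u hu) (facets_nonneg hl _)
          linarith [hg0 u]
        · rw [hgeq u hu, hg'eq u hu, hsa x hx, hsa y hy, sub_self]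
      have h2 := Finset.sum_le_sum fun u (_ : u ∈ Finset.univ) => h1 u
      rw [Finset.sum_sub_distrib, ← hg, ← hg', ← dotProduct_sub, h, Finset.sum_ite_mem,
        Finset.univ_inter, Finset.sum_neg_distrib, ← Finset.mul_sum, dotProduct_smul,
        smul_eq_mul] at h2
      have h3 := mul_le_mul_of_nonneg_left (D.sum_facet_le H hQ hT hp hl (bigParts v T))
        (Nat.cast_nonneg (α := ℝ) A)
      push_cast at h2
      have h4 : (0 : ℝ) ≤ weightBound Q * A := by positivity
      by_contra! h5
      nlinarith
    rw [hz0, smul_zero] at h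
    exact sub_eq_zero.1 h

end CayleyDecomp

end

section

open GorPoint

variable {n : ℕ} {J : Type*} [Fintype J]

lemma sum_choose_le {ι : Type*} [Fintype ι] [DecidableEq ι] {q : ℕ}
    (hq : Fintype.card ι + q = n + 1) (u : ι) (m : ℕ) :
    ∑ a ∈ (Finset.univ : Finset ι).piAntidiag m, (a u + q).choose q ≤ (n + m).choose n := by
  have h1 : ∀ a : ℕ, ((Finset.univ : Finset (Option (Fin q))).piAntidiag a).card
      = (a + q).choose q := fun a => by
    rw [card_piAntidiag, Finset.card_univ, Fintype.card_option, Fintype.card_fin,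
      show q + 1 + a - 1 = a + q by omega, Nat.choose_symm_add]
  have h2 : ((Finset.univ : Finset (ι ⊕ Fin q)).piAntidiag m).card = (n + m).choose n := by
    rw [card_piAntidiag, Finset.card_univ, Fintype.card_sum, Fintype.card_fin, hq,
      show n + 1 + m - 1 = n + m by omega, Nat.choose_symm_add]
  simp only [← h1, ← h2]
  rw [← Finset.card_sigma]
  refine Finset.card_le_card_of_injOn (fun x : Σ _ : ι → ℕ, Option (Fin q) → ℕ =>
    Sum.elim (fun i => if i = u then x.2 none else x.1 i) fun j => x.2 (some j)) ?_ ?_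
  · rintro ⟨a, c⟩ h
    simp only [Finset.mem_coe, Finset.mem_sigma, Finset.mem_piAntidiag, Fintype.sum_option] at h
    simp only [Finset.mem_coe, Finset.mem_piAntidiag, Fintype.sum_sum_type, Sum.elim_inl,
      Sum.elim_inr, Finset.mem_univ, implies_true, and_true]
    rw [← h.1.1, ← Finset.add_sum_erase _ _ (Finset.mem_univ u),
      ← Finset.add_sum_erase _ a (Finset.mem_univ u), ← h.2.1, if_pos rfl,
      Finset.sum_congr rfl fun i hi => if_neg (Finset.ne_of_mem_erase hi)]
    ring
  · rintro ⟨a, c⟩ h ⟨a', c'⟩ h' he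
    simp only [Finset.mem_coe, Finset.mem_sigma, Finset.mem_piAntidiag] at h h'
    have hinl := fun i => congrFun he (Sum.inl i)
    have hinr := fun j => congrFun he (Sum.inr j)
    simp only [Sum.elim_inl, Sum.elim_inr] at hinl hinr
    have hc : c = c' := by
      ext (_ | j)
      · simpa using hinl u
      · exact hinr j
    have ha : a = a' := by
      ext i
      by_cases hi : i = u
      · rw [hi, ← h.2.1, ← h'.2.1, hc]
      · simpa [hi] using hinl i
    rw [ha, hc]

namespace CayleyDecomp

variable {v : J → Fin (n + 1) → ℝ} {ξ w : Fin (n + 1) → ℝ} {r : ℕ}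
  {T : Finset (Fin (n + 1) → ℝ)}

lemma card_slice_le (H : GorPoint v ξ w r) (D : CayleyDecomp v w T) {Q : ℕ} (hQ : 1 ≤ Q)
    (hT : n + 1 ≤ T.card + Q) (m : ℕ) (s : Finset (Fin (n + 1) → ℝ))
    (hs : ∀ x ∈ s, x ∈ slice (coneHull v) m) :
    s.card ≤ Q.factorial * (weightBound Q + 1) ^ (2 * Q) * (n + m).choose n := by
  classical
  have hTn : T.card ≤ n + 1 := by have := D.finrank_ker H; omega
  obtain ⟨q, hq⟩ := Nat.exists_eq_add_of_le hTn
  set W := weightBound Q with hW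
  have hqQ : q ≤ Q := by omega
  have hdot : ∀ x ∈ s, ∀ u : T, u.1 ⬝ᵥ x = (⌊u.1 ⬝ᵥ x⌋₊ : ℝ) := by
    intro x hx u
    obtain ⟨z, hz⟩ := exists_int_dotProduct (D.lattice u.1 u.2) (hs x hx).1
    have h0 : 0 ≤ u.1 ⬝ᵥ x := coneHull_nonneg (f := dotL u.1) (D.nonneg u.1 u.2) (hs x hx).2.1
    rw [hz] at h0 ⊢
    lift z to ℕ using by exact_mod_cast h0
    simp
  have hmaps : ∀ x ∈ s, (fun u : T => ⌊u.1 ⬝ᵥ x⌋₊) ∈ (Finset.univ : Finset T).piAntidiag m := by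
    intro x hx
    rw [Finset.mem_piAntidiag]
    refine ⟨?_, fun _ _ => Finset.mem_univ _⟩
    have h1 := D.sum_dot x
    rw [Finset.sum_congr rfl fun u _ => hdot x hx u, (hs x hx).2.2] at h1
    exact_mod_cast h1
  set X := (W + 1) ^ q * q.factorial with hX
  have hX0 : 1 ≤ X := Nat.mul_pos (by positivity) q.factorial_pos
  have hfib : ∀ a : T → ℕ, (s.filter fun x => (fun u : T => ⌊u.1 ⬝ᵥ x⌋₊) = a).card
      ≤ 1 + ∑ u ∈ bigParts v T, X * (a u + q).choose q := by
    intro a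
    have h1 := D.card_fibre_le H hQ hT (a := a) (A := (bigParts v T).sup a)
      (fun u hu => Finset.le_sup hu)
      (s.filter fun x => (fun u : T => ⌊u.1 ⬝ᵥ x⌋₊) = a)
      (fun x hx => (hs x (Finset.mem_filter.1 hx).1).1)
      (fun x hx => (hs x (Finset.mem_filter.1 hx).1).2.1)
      (fun x hx u => by
        rw [hdot x (Finset.mem_filter.1 hx).1, ← (Finset.mem_filter.1 hx).2])
    rw [← hW, show n + 1 - T.card = q by omega] at h1
    refine h1.trans ?_
    rcases (bigParts v T).eq_empty_or_nonempty with he | hne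
    · simp [he]
    · obtain ⟨u, hu, hsup⟩ := Finset.exists_mem_eq_sup _ hne a
      rw [hsup]
      refine le_trans ?_ (Nat.le_add_left _ _)
      refine le_trans ?_ (Finset.single_le_sum (f := fun u => X * (a u + q).choose q)
        (fun _ _ => Nat.zero_le _) hu)
      calc (1 + W * a u) ^ q ≤ ((W + 1) * (a u + 1)) ^ q := Nat.pow_le_pow_left (by nlinarith) q
        _ = (W + 1) ^ q * (a u + 1) ^ q := mul_pow _ _ _
        _ ≤ (W + 1) ^ q * (q.factorial * (a u + q).choose q) := by
            refine Nat.mul_le_mul_left _ ?_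
            rw [← Nat.ascFactorial_eq_factorial_mul_choose]
            exact Nat.pow_succ_le_ascFactorial _ _
        _ = X * (a u + q).choose q := by rw [hX]; ring
  have hone : ((Finset.univ : Finset T).piAntidiag m).card ≤ (n + m).choose n := by
    rw [card_piAntidiag, Finset.card_univ, Fintype.card_coe, Nat.choose_symm_add]
    exact Nat.choose_le_choose m (by omega)
  have hbig : (bigParts v T).card + 1 ≤ (W + 1) ^ q := by
    have := D.card_bigParts_lt H hQ hT
    rwa [show n + 1 - T.card = q by omega] at this
  calc s.card = ∑ a ∈ (Finset.univ : Finset T).piAntidiag m,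
        (s.filter fun x => (fun u : T => ⌊u.1 ⬝ᵥ x⌋₊) = a).card :=
        Finset.card_eq_sum_card_fiberwise hmaps
    _ ≤ ∑ a ∈ (Finset.univ : Finset T).piAntidiag m,
        (1 + ∑ u ∈ bigParts v T, X * (a u + q).choose q) := Finset.sum_le_sum fun a _ => hfib a
    _ = ((Finset.univ : Finset T).piAntidiag m).card + ∑ u ∈ bigParts v T, X *
        ∑ a ∈ (Finset.univ : Finset T).piAntidiag m, (a u + q).choose q := by
        rw [Finset.sum_add_distrib, Finset.sum_comm, Finset.card_eq_sum_ones]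
        simp only [Finset.mul_sum]
    _ ≤ (n + m).choose n + ∑ u ∈ bigParts v T, X * (n + m).choose n :=
        Nat.add_le_add hone (Finset.sum_le_sum fun u _ => Nat.mul_le_mul_left _
          (sum_choose_le (by rw [Fintype.card_coe]; exact hq.symm) u m))
    _ = (1 + (bigParts v T).card * X) * (n + m).choose n := by
        rw [Finset.sum_const, smul_eq_mul]; ring
    _ ≤ Q.factorial * (W + 1) ^ (2 * Q) * (n + m).choose n := by
        refine Nat.mul_le_mul_right _ ?_
        calc 1 + (bigParts v T).card * X ≤ ((bigParts v T).card + 1) * X := by nlinarith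
          _ ≤ (W + 1) ^ q * X := Nat.mul_le_mul_right _ hbig
          _ = q.factorial * (W + 1) ^ (2 * q) := by rw [hX]; ring
          _ ≤ Q.factorial * (W + 1) ^ (2 * Q) := Nat.mul_le_mul (Nat.factorial_le hqQ)
              (Nat.pow_le_pow_right (by omega) (by omega))

end CayleyDecomp

end

section

open GorPoint

variable {n : ℕ}

lemma card_inter_smul_lattice (P : Set (Fin n → ℝ)) {m : ℕ} (hm : 0 < m) :
    Nat.card ↑(P ∩ (m : ℝ)⁻¹ •
      (Submodule.span ℤ (Set.range (Pi.basisFun ℝ (Fin n))) : Set (Fin n → ℝ)))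
      = latticePointCount ((m : ℝ) • P) := by
  have hm0 : (m : ℝ) ≠ 0 := by positivity
  have hinj : Function.Injective fun (z : Fin n → ℤ) => (m : ℝ)⁻¹ • fun i => (z i : ℝ) := by
    intro z z' h
    ext i
    have := congrFun (smul_right_injective _ (inv_ne_zero hm0) h) i
    exact_mod_cast this
  rw [latticePointCount, ← Set.ncard_image_of_injective _ hinj, Nat.card_coe_set_eq]
  congr 1
  ext x
  simp only [Set.mem_inter_iff, Set.mem_image, Set.mem_ofPred_eq, Set.mem_smul_set_iff_inv_smul_mem₀
    hm0, Set.mem_smul_set_iff_inv_smul_mem₀ (inv_ne_zero hm0), inv_inv, SetLike.mem_coe,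
    Module.Basis.mem_span_iff_repr_mem]
  constructor
  · rintro ⟨hx, hl⟩
    choose z hz using hl
    have hz' : (fun i => (z i : ℝ)) = (m : ℝ) • x := by
      ext i
      simpa using hz i
    refine ⟨z, ?_, ?_⟩
    · rwa [hz', inv_smul_smul₀ hm0]
    · rw [hz', inv_smul_smul₀ hm0]
  · rintro ⟨z, hz, rfl⟩
    refine ⟨hz, fun i => ⟨z i, ?_⟩⟩
    rw [smul_inv_smul₀ hm0]
    simp

/-- A bound on the lattice point counts of the dilates bounds the normalized volume. -/
lemma normVol_le {P : Set (Fin n → ℝ)} (hP : IsLatticePolytope P) {B : ℝ} (hB0 : 0 ≤ B)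
    (hB : ∀ m : ℕ, (latticePointCount ((m : ℝ) • P) : ℝ) ≤ B * (n + m).choose n) :
    normVol P ≤ B := by
  obtain ⟨V, -, -, rfl⟩ := hP
  have hcomp : IsCompact (convexHull ℝ (V : Set (Fin n → ℝ))) :=
    V.finite_toSet.isCompact_convexHull ℝ
  have hlim := (tendsto_card_div_pow_atTop_volume _ hcomp.isBounded
    hcomp.isClosed.measurableSet ((convex_convexHull ℝ _).addHaar_frontier _)).const_mul
      (n.factorial : ℝ)
  have hlim' : Tendsto (fun m : ℕ => B * (1 + (n : ℝ) / m) ^ n) atTop (𝓝 B) := by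
    have h1 := ((tendsto_const_div_atTop_nhds_zero_nat (n : ℝ)).const_add 1).pow n |>.const_mul B
    simpa using h1
  refine le_of_tendsto_of_tendsto hlim hlim' ?_
  filter_upwards [eventually_gt_atTop 0] with m hm
  rw [card_inter_smul_lattice _ hm, Fintype.card_fin]
  have hm' : (0 : ℝ) < m := by exact_mod_cast hm
  have h1 : (n.factorial * (n + m).choose n : ℝ) ≤ (n + m) ^ n := by
    have := Nat.descFactorial_le_pow (n + m) n
    rw [Nat.descFactorial_eq_factorial_mul_choose] at this
    exact_mod_cast this
  rw [one_add_div hm'.ne', div_pow, ← mul_div_assoc, ← mul_div_assoc, add_comm (m : ℝ)]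
  refine div_le_div_of_nonneg_right ?_ (by positivity)
  calc (n.factorial : ℝ) * latticePointCount ((m : ℝ) • convexHull ℝ (V : Set (Fin n → ℝ)))
      ≤ n.factorial * (B * (n + m).choose n) :=
        mul_le_mul_of_nonneg_left (hB m) (Nat.cast_nonneg _)
    _ = B * (n.factorial * (n + m).choose n) := by ring
    _ ≤ B * (n + m) ^ n := mul_le_mul_of_nonneg_left h1 hB0

/-- The vertices of a polytope, placed at height one. -/
def homogenization (V : Finset (Fin n → ℝ)) (i : V) : Fin (n + 1) → ℝ := Fin.cons 1 i.1

lemma cons_mem_coneHull {V : Finset (Fin n → ℝ)} (hV : V.Nonempty) (m : ℕ) (y : Fin n → ℝ) :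
    (Fin.cons (m : ℝ) y : Fin (n + 1) → ℝ) ∈ coneHull (homogenization V) ↔
      y ∈ (m : ℝ) • convexHull ℝ (V : Set (Fin n → ℝ)) := by
  have hsum : ∀ c : V → ℝ, ∑ i, c i • homogenization V i
      = Fin.cons (∑ i, c i) (∑ i, c i • i.1) := by
    intro c
    ext j
    refine Fin.cases ?_ (fun j => ?_) j <;> simp [homogenization]
  constructor
  · rintro ⟨c, hc, h⟩
    rw [hsum, Fin.cons_inj] at h
    obtain ⟨h1, h2⟩ := h
    rcases Nat.eq_zero_or_pos m with rfl | hm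
    · have hc0 : ∀ i, c i = 0 := fun i =>
        (Finset.sum_eq_zero_iff_of_nonneg fun i _ => hc i).1 (by simpa using h1) i
          (Finset.mem_univ i)
      obtain ⟨x, hx⟩ := hV
      exact ⟨x, subset_convexHull ℝ _ hx, by simp [← h2, hc0]⟩
    · have hm' : (0 : ℝ) < m := by exact_mod_cast hm
      refine ⟨∑ i, (c i / m) • i.1, ?_, ?_⟩
      · refine (convex_convexHull ℝ _).sum_mem (fun i _ => div_nonneg (hc i) hm'.le) ?_
          fun i _ => subset_convexHull ℝ _ i.2
        rw [← Finset.sum_div, h1, div_self hm'.ne']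
      · simp only [Finset.smul_sum, smul_smul, mul_div_cancel₀ _ hm'.ne']
        exact h2
  · rintro ⟨x, hx, rfl⟩
    obtain ⟨c, hc, hc1, hcx⟩ := Finset.mem_convexHull'.1 hx
    refine ⟨fun i => m * c i.1, fun i => mul_nonneg (Nat.cast_nonneg _) (hc _ i.2), ?_⟩
    rw [hsum, Fin.cons_inj]
    constructor
    · rw [← Finset.mul_sum, Finset.sum_coe_sort V c, hc1, mul_one]
    · simp only [mul_smul, ← Finset.smul_sum]
      rw [Finset.sum_coe_sort V fun x => c x • x, hcx]

lemma ncard_slice_homogenization {V : Finset (Fin n → ℝ)} (hV : V.Nonempty) (m : ℕ) :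
    (slice (coneHull (homogenization V)) m).ncard
      = latticePointCount ((m : ℝ) • convexHull ℝ (V : Set (Fin n → ℝ))) := by
  have hinj : Function.Injective fun z : Fin n → ℤ =>
      (Fin.cons (m : ℝ) fun i => (z i : ℝ) : Fin (n + 1) → ℝ) := by
    intro z z' h
    ext i
    have := congrFun (Fin.cons_inj.1 h).2 i
    exact_mod_cast this
  rw [latticePointCount, ← Set.ncard_image_of_injective _ hinj]
  congr 1
  ext x
  constructor
  · rintro ⟨hl, hx, hx0⟩
    obtain ⟨z, rfl⟩ := mem_lat_iff_exists.1 hl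
    have h1 : (fun i => (z i : ℝ)) = Fin.cons (m : ℝ) fun i => (z (Fin.succ i) : ℝ) := by
      ext j
      refine Fin.cases ?_ (fun j => ?_) j
      · simpa using hx0
      · simp
    exact ⟨fun i => z i.succ, (cons_mem_coneHull hV m _).1 (h1 ▸ hx), h1.symm⟩
  · rintro ⟨z, hz, rfl⟩
    refine ⟨fun j => ?_, (cons_mem_coneHull hV m _).2 hz, rfl⟩
    refine Fin.cases ⟨m, by simp⟩ (fun j => ⟨z j, by simp⟩) j

lemma span_homogenization {V : Finset (Fin n → ℝ)}
    (hV : affineSpan ℝ (convexHull ℝ (V : Set (Fin n → ℝ))) = ⊤) :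
    Submodule.span ℝ (Set.range (homogenization V)) = ⊤ := by
  set S := Submodule.span ℝ (Set.range (homogenization V)) with hS
  let A : AffineSubspace ℝ (Fin n → ℝ) :=
    { carrier := {y | (Fin.cons 1 y : Fin (n + 1) → ℝ) ∈ S}
      smul_vsub_vadd_mem' := by
        intro c y₁ y₂ y₃ h₁ h₂ h₃
        have h := S.add_mem (S.smul_mem c (S.sub_mem h₁ h₂)) h₃
        have he : (Fin.cons 1 (c • (y₁ -ᵥ y₂) +ᵥ y₃) : Fin (n + 1) → ℝ)
            = c • (Fin.cons 1 y₁ - Fin.cons 1 y₂) + Fin.cons 1 y₃ := by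
          ext j
          refine Fin.cases ?_ (fun j => ?_) j <;> simp
        rw [Set.mem_ofPred_eq, he]
        exact h }
  have hA : A = ⊤ := by
    rw [eq_top_iff, ← hV, affineSpan_convexHull]
    exact affineSpan_le.2 fun y hy => Submodule.subset_span ⟨⟨y, hy⟩, rfl⟩
  have hmem : ∀ y, (Fin.cons 1 y : Fin (n + 1) → ℝ) ∈ S := fun y => by
    have : y ∈ A := hA ▸ AffineSubspace.mem_top ℝ _ y
    exact this
  refine eq_top_iff.2 fun x _ => ?_
  have he : x = (Fin.cons 1 (Fin.tail x) - Fin.cons 1 0) + x 0 • Fin.cons 1 0 := by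
    ext j
    refine Fin.cases ?_ (fun j => ?_) j <;> simp [Fin.tail]
  rw [he]
  exact S.add_mem (S.sub_mem (hmem _) (hmem _)) (S.smul_mem _ (hmem _))

end

section

open GorPoint

lemma weightBound_lt (Q : ℕ) : weightBound Q + 1 ≤ 14 ^ (Q * 2 ^ Q) := by
  have h1 : ∀ Q : ℕ, 2 * Q * (Q + 1) + 1 ≤ 7 ^ Q := by
    intro Q
    induction Q with
    | zero => simp
    | succ Q ih => rw [pow_succ]; nlinarith
  have h2 : 2 * Q * (Q + 1) * 2 ^ Q + 1 ≤ 14 ^ Q := by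
    calc 2 * Q * (Q + 1) * 2 ^ Q + 1 ≤ (2 * Q * (Q + 1) + 1) * 2 ^ Q := by
          nlinarith [Nat.one_le_two_pow (n := Q)]
      _ ≤ 7 ^ Q * 2 ^ Q := Nat.mul_le_mul_right _ (h1 Q)
      _ = 14 ^ Q := by rw [← mul_pow]; norm_num
  calc weightBound Q + 1 ≤ (2 * Q * (Q + 1) * 2 ^ Q + 1) ^ 2 ^ Q :=
        Nat.pow_lt_pow_left (Nat.lt_succ_self _) (by positivity)
    _ ≤ (14 ^ Q) ^ 2 ^ Q := Nat.pow_le_pow_left h2 _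
    _ = 14 ^ (Q * 2 ^ Q) := (pow_mul _ _ _).symm

lemma factorial_mul_weightBound_le {Q : ℕ} (hQ : 1 ≤ Q) :
    Q.factorial * (weightBound Q + 1) ^ (2 * Q)
      ≤ Q ^ Q * Q.factorial ^ (Q + 1) * 14 ^ (Q ^ 2 * 2 ^ (Q + 1)) := by
  have h1 : (weightBound Q + 1) ^ (2 * Q) ≤ 14 ^ (Q ^ 2 * 2 ^ (Q + 1)) := by
    calc (weightBound Q + 1) ^ (2 * Q) ≤ (14 ^ (Q * 2 ^ Q)) ^ (2 * Q) :=
          Nat.pow_le_pow_left (weightBound_lt Q) _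
      _ = 14 ^ (Q ^ 2 * 2 ^ (Q + 1)) := by rw [← pow_mul]; congr 1; ring
  refine Nat.mul_le_mul ?_ h1
  calc Q.factorial ≤ Q.factorial ^ (Q + 1) := Nat.le_self_pow (by omega) _
    _ ≤ Q ^ Q * Q.factorial ^ (Q + 1) := Nat.le_mul_of_pos_left _ (by positivity)

lemma GorPoint.ncard_slice_le {n : ℕ} {J : Type*} [Fintype J] {v : J → Fin (n + 1) → ℝ}
    {ξ w : Fin (n + 1) → ℝ} {r : ℕ} (H : GorPoint v ξ w r) {d : ℕ} (hd : 0 < d)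
    (hrd : r + d = n + 1) (m : ℕ) :
    (slice (coneHull v) m).ncard ≤ (2 * d - 1).factorial *
      (weightBound (2 * d - 1) + 1) ^ (2 * (2 * d - 1)) * (n + m).choose n := by
  obtain ⟨T, D, hT⟩ := H.exists_cayleyDecomp hd hrd
  by_cases hfin : (slice (coneHull v) m).Finite
  · rw [Set.ncard_eq_toFinset_card _ hfin]
    exact D.card_slice_le H (by omega) hT m _ fun x hx => hfin.mem_toFinset.1 hx
  · rw [Set.Infinite.ncard hfin]
    exact Nat.zero_le _

lemma gorData_homogenization {n d : ℕ} {V : Finset (Fin n → ℝ)} (hV : V.Nonempty)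
    (hVl : ∀ v ∈ V, IsLatticePoint v) {h : Polynomial ℤ}
    (hfull : affineSpan ℝ (convexHull ℝ (V : Set (Fin n → ℝ))) = ⊤)
    (hh : IsHStarPoly (convexHull ℝ (V : Set (Fin n → ℝ))) h) (hdeg : h.natDegree = d)
    (hsym : ∀ i ≤ d, h.coeff i = h.coeff (d - i)) : GorData (homogenization V) h d where
  lattice i j := by
    refine Fin.cases ⟨1, by simp [homogenization]⟩ (fun j => ?_) j
    simpa [homogenization] using hVl i.1 i.2 j
  height _ := rfl
  span := span_homogenization hfull
  count m := by
    rw [ncard_slice_homogenization hV, hh.2.2 m, Finset.sum_range_succ _ (n + 1),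
      Polynomial.coeff_eq_zero_of_natDegree_lt (Nat.lt_succ_of_le hh.1), zero_mul, add_zero]
    exact Finset.sum_congr rfl fun j hj => by
      rw [monoCount_eq (Nat.lt_succ_iff.1 (Finset.mem_range.1 hj))]
  natDegree_eq := hdeg
  degree_le := hdeg ▸ hh.1
  symm := hsym

end

end GorensteinCone

open GorensteinCone

/-- (Corollary 3.2.) Every Gorenstein polytope of degree `d` satisfies
`Vol(P) ≤ (2d−1)^{2d−1} · ((2d−1)!)^{2d} · 14^{(2d−1)²·2^{2d}}`. -/
theorem statement14 (n d : ℕ) (P : Set (Fin n → ℝ)) (h : Polynomial ℤ)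
    (hP : IsLatticePolytope P) (hfull : affineSpan ℝ P = ⊤)
    (hh : IsHStarPoly P h) (hdeg : h.natDegree = d)
    (hsym : ∀ i ≤ d, h.coeff i = h.coeff (d - i)) :
    normVol P ≤
      (((2 * d - 1 : ℕ)) : ℝ) ^ (2 * d - 1) *
        (((2 * d - 1).factorial : ℝ)) ^ (2 * d) *
        (14 : ℝ) ^ ((2 * d - 1) ^ 2 * 2 ^ (2 * d)) := by
  obtain ⟨V, hV, hVl, rfl⟩ := id hP
  have hG := gorData_homogenization hV hVl hfull hh hdeg hsym
  rcases Nat.eq_zero_or_pos d with rfl | hd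
  · have hcount : ∀ m : ℕ,
        (latticePointCount ((m : ℝ) • convexHull ℝ (V : Set (Fin n → ℝ))) : ℤ)
          = h.coeff 0 * ((n + m).choose n : ℤ) := fun m => by
      rw [hh.2.2 m, Finset.sum_eq_single_of_mem 0 (by simp) fun i _ hi => by
        rw [Polynomial.coeff_eq_zero_of_natDegree_lt (by omega), zero_mul]]
      simp
    have h0 : h.coeff 0 = 1 := by
      have h1 := hcount 0
      rw [← ncard_slice_homogenization hV, slice_zero hG.height] at h1
      simpa using h1.symm
    have hle : normVol (convexHull ℝ (V : Set (Fin n → ℝ))) ≤ 1 :=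
      normVol_le hP zero_le_one fun m => by
        have h1 := hcount m
        rw [h0] at h1
        exact_mod_cast h1.le
    simpa using hle
  · obtain ⟨ξ, hξg, hξi, hξc⟩ := exists_generic_isInner hG.span
    obtain ⟨w, hwl, hwi, hw0, hw⟩ := hG.exists_point hξg hξc
    have hdn := hG.degree_le
    have H : GorPoint (homogenization V) ξ w (n + 1 - d) :=
      ⟨hG.lattice, hG.height, hG.span, hξi, hξc, hwl, hwi, hw0, by omega, hw⟩
    have hle : normVol (convexHull ℝ (V : Set (Fin n → ℝ))) ≤
        ((2 * d - 1).factorial * (weightBound (2 * d - 1) + 1) ^ (2 * (2 * d - 1)) : ℕ) :=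
      normVol_le hP (Nat.cast_nonneg _) fun m => by
        rw [← ncard_slice_homogenization hV]
        exact_mod_cast H.ncard_slice_le hd (by omega) m
    refine hle.trans ?_
    have hnum := factorial_mul_weightBound_le (Q := 2 * d - 1) (by omega)
    rw [show 2 * d - 1 + 1 = 2 * d by omega] at hnum
    exact_mod_cast hnum

end
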